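/- Let n > 2 be an integer, let d₁, d₂ ≥ 1, and let C ≥ 0. Suppose u : ℝⁿ → ℝ^{d₁} and v : ℝⁿ → ℝ^{d₂} are smooth on an open neighborhood of the origin in ℝⁿ and satisfy, on that neighborhood, |Δu(x)| ≤ C( |u(x)| + ‖Du(x)‖ + |v(x)| ) and |⟨x, ∇⟩ v(x)| ≤ C( |v(x)| + |u(x)| + ‖Du(x)‖ ), where Δ is applied componentwise, Du(x) denotes the total (Fréchet) derivative of u at x with its operator norm ‖Du(x)‖, and ⟨x, ∇⟩v(x) = Dv(x)(x) is the derivative of v along the radial vector field. If both u and v vanish to infinite order at the origin (all iterated derivatives of every component vanish at 0), then u ≡ 0 and v ≡ 0 on some open neighborhood of the origin. -/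

import Mathlib

open MeasureTheory Metric

/-- The Euclidean Laplacian applied componentwise to a vector-valued function:
`Δu(x) = ∑ i, ∂²u/∂xᵢ²(x) ∈ ℝ^d`. -/
noncomputable def lapV {n d : ℕ} (u : EuclideanSpace ℝ (Fin n) → EuclideanSpace ℝ (Fin d))
    (x : EuclideanSpace ℝ (Fin n)) : EuclideanSpace ℝ (Fin d) :=
  ∑ i : Fin n,
    iteratedFDeriv ℝ 2 u x ![EuclideanSpace.single i (1 : ℝ), EuclideanSpace.single i (1 : ℝ)]

section LineDerivative

variable {E : Type*} [AddCommGroup E] [Module ℝ E] {f g : E → ℝ} {f' g' : ℝ} {x v : E}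

lemma HasLineDerivAt.fun_add (hf : HasLineDerivAt ℝ f f' x v) (hg : HasLineDerivAt ℝ g g' x v) :
    HasLineDerivAt ℝ (fun y => f y + g y) (f' + g') x v :=
  HasDerivAt.fun_add hf hg

lemma HasLineDerivAt.fun_sub (hf : HasLineDerivAt ℝ f f' x v) (hg : HasLineDerivAt ℝ g g' x v) :
    HasLineDerivAt ℝ (fun y => f y - g y) (f' - g') x v :=
  HasDerivAt.fun_sub hf hg

lemma HasLineDerivAt.fun_mul (hf : HasLineDerivAt ℝ f f' x v) (hg : HasLineDerivAt ℝ g g' x v) :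
    HasLineDerivAt ℝ (fun y => f y * g y) (f' * g x + f x * g') x v := by
  simpa only [HasLineDerivAt, zero_smul, add_zero] using HasDerivAt.fun_mul hf hg

lemma HasLineDerivAt.fun_sum {ι : Type*} {s : Finset ι} {F : ι → E → ℝ} {F' : ι → ℝ}
    (h : ∀ j ∈ s, HasLineDerivAt ℝ (F j) (F' j) x v) :
    HasLineDerivAt ℝ (fun y => ∑ j ∈ s, F j y) (∑ j ∈ s, F' j) x v :=
  HasDerivAt.fun_sum h

lemma HasDerivAt.comp_hasLineDerivAt {φ : ℝ → ℝ} {φ' : ℝ} (hφ : HasDerivAt φ φ' (f x))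
    (hf : HasLineDerivAt ℝ f f' x v) :
    HasLineDerivAt ℝ (fun y => φ (f y)) (φ' * f') x v := by
  have h0 : HasDerivAt φ φ' ((fun t : ℝ => f (x + t • v)) 0) := by simpa using hφ
  exact HasDerivAt.comp (0 : ℝ) h0 hf

end LineDerivative

/-- The squared Euclidean norm as a sum of squares of coordinates. -/
def sumSq {n : ℕ} (x : EuclideanSpace ℝ (Fin n)) : ℝ := ∑ j, x j ^ 2

section Pohozaev

variable {n : ℕ}

local notation "𝔼" => EuclideanSpace ℝ (Fin n)

local notation "∂ₑ" i => EuclideanSpace.single i (1 : ℝ)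

lemma hasLineDerivAt_coord (x : 𝔼) (i j : Fin n) :
    HasLineDerivAt ℝ (fun y : 𝔼 => y j) (if j = i then 1 else 0) x (∂ₑ i) := by
  have : HasDerivAt (fun t : ℝ => x j + t * (if j = i then 1 else 0)) (if j = i then 1 else 0) 0 := by
    simpa using ((hasDerivAt_id (0 : ℝ)).mul_const (if j = i then (1 : ℝ) else 0)).const_add (x j)
  simpa [HasLineDerivAt] using this

lemma hasLineDerivAt_sumSq (x : 𝔼) (i : Fin n) :
    HasLineDerivAt ℝ sumSq (2 * x i) x (∂ₑ i) := by
  have h : HasLineDerivAt ℝ (fun y : 𝔼 => ∑ j, y j * y j) _ x (∂ₑ i) :=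
    HasLineDerivAt.fun_sum fun j _ => (hasLineDerivAt_coord x i j).fun_mul (hasLineDerivAt_coord x i j)
  convert h using 1
  · ext y; simp [sumSq, sq]
  · simp [Finset.sum_add_distrib]; ring

/-- Pohozaev-type identity: the divergence of the field
`2 b (x·Z) Z - b |Z|² x + c z Z + g z² x`, where `Z = ∇z` and `b`, `c`, `g` are radial. -/
lemma pohozaev_divergence {b c g z : 𝔼 → ℝ} {Z : Fin n → 𝔼 → ℝ} {x : 𝔼} {b₁ c₁ g₁ : ℝ}
    {H : Fin n → Fin n → ℝ} (hH : ∀ i j, H i j = H j i)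
    (hb : ∀ i, HasLineDerivAt ℝ b (b₁ * x i) x (∂ₑ i))
    (hc : ∀ i, HasLineDerivAt ℝ c (c₁ * x i) x (∂ₑ i))
    (hg : ∀ i, HasLineDerivAt ℝ g (g₁ * x i) x (∂ₑ i))
    (hz : ∀ i, HasLineDerivAt ℝ z (Z i x) x (∂ₑ i))
    (hZ : ∀ i j, HasLineDerivAt ℝ (Z j) (H i j) x (∂ₑ i)) :
    ∃ D : Fin n → ℝ, (∀ i, HasLineDerivAt ℝ (fun y =>
        2 * (b y * ((∑ j, y j * Z j y) * Z i y)) - b y * ((∑ j, Z j y * Z j y) * y i)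
          + c y * (z y * Z i y) + g y * (z y * z y * y i)) (D i) x (∂ₑ i)) ∧
      ∑ i, D i = 2 * b x * (∑ j, x j * Z j x) * (∑ i, H i i) + c x * z x * (∑ i, H i i)
        + 2 * b₁ * (∑ j, x j * Z j x) ^ 2
        + ((2 - n) * b x - b₁ * sumSq x + c x) * (∑ j, Z j x * Z j x)
        + (c₁ * z x + 2 * g x * z x) * (∑ j, x j * Z j x)
        + (g₁ * sumSq x + n * g x) * z x ^ 2 := by
  have hA : ∀ i, HasLineDerivAt ℝ (fun y : 𝔼 => ∑ j, y j * Z j y)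
      (Z i x + ∑ j, x j * H i j) x (∂ₑ i) := fun i => by
    have := HasLineDerivAt.fun_sum (s := Finset.univ)
      fun j _ => (hasLineDerivAt_coord x i j).fun_mul (hZ i j)
    simpa [Finset.sum_add_distrib] using this
  have hN : ∀ i, HasLineDerivAt ℝ (fun y : 𝔼 => ∑ j, Z j y * Z j y)
      (2 * ∑ j, Z j x * H i j) x (∂ₑ i) := fun i => by
    have := HasLineDerivAt.fun_sum (s := Finset.univ)
      fun j _ => (hZ i j).fun_mul (hZ i j)
    convert this using 1
    rw [Finset.mul_sum]
    exact Finset.sum_congr rfl fun j _ => by ring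
  have h2 : ∀ i, HasLineDerivAt ℝ (fun _ : 𝔼 => (2 : ℝ)) 0 x (∂ₑ i) := fun i =>
    hasDerivAt_const _ _
  refine ⟨_, fun i => ((((h2 i).fun_mul ((hb i).fun_mul ((hA i).fun_mul (hZ i i)))).fun_sub
    ((hb i).fun_mul ((hN i).fun_mul (hasLineDerivAt_coord x i i)))).fun_add
    ((hc i).fun_mul ((hz i).fun_mul (hZ i i)))).fun_add
    ((hg i).fun_mul (((hz i).fun_mul (hz i)).fun_mul (hasLineDerivAt_coord x i i))), ?_⟩
  have hX : ∑ i, (∑ j, x j * H i j) * Z i x = ∑ i, (∑ j, Z j x * H i j) * x i := by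
    simp only [Finset.sum_mul]
    rw [Finset.sum_comm]
    exact Finset.sum_congr rfl fun i _ => Finset.sum_congr rfl fun j _ => by rw [hH j i]; ring
  generalize hAe : ∑ j, x j * Z j x = A
  generalize hNe : ∑ j, Z j x * Z j x = N at *
  have key : ∀ i, (0 * (b x * (A * Z i x)) +
      2 * (b₁ * x i * (A * Z i x) + b x * ((Z i x + ∑ j, x j * H i j) * Z i x + A * H i i)) -
      (b₁ * x i * (N * x i) + b x * (2 * (∑ j, Z j x * H i j) * x i + N * if i = i then 1 else 0)) +
      (c₁ * x i * (z x * Z i x) + c x * (Z i x * Z i x + z x * H i i)) +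
      (g₁ * x i * (z x * z x * x i) +
        g x * ((Z i x * z x + z x * Z i x) * x i + z x * z x * if i = i then 1 else 0))) =
      (2 * b₁ * A + c₁ * z x + 2 * g x * z x) * (x i * Z i x) + (2 * b x + c x) * (Z i x * Z i x)
      + 2 * b x * ((∑ j, x j * H i j) * Z i x) - 2 * b x * ((∑ j, Z j x * H i j) * x i)
      + (2 * b x * A + c x * z x) * H i i
      + (g₁ * z x ^ 2 - b₁ * N) * x i ^ 2 + (g x * z x ^ 2 - b x * N) := fun i => by
    simp only [if_true]; ring
  rw [Finset.sum_congr rfl fun i _ => key i]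
  simp only [Finset.sum_add_distrib, Finset.sum_sub_distrib, ← Finset.mul_sum, hX, hAe, hNe,
    Finset.sum_const, Finset.card_univ, Fintype.card_fin, nsmul_eq_mul, sumSq]
  ring

/-- The radial profile of the Carleman weight, as a function of `s = |x|²`. -/
noncomputable def carlemanProfile (m : ℕ) (s : ℝ) : ℝ := s⁻¹ ^ m * Real.exp (m / 2 * s)

lemma carlemanProfile_pos (m : ℕ) {s : ℝ} (hs : 0 < s) : 0 < carlemanProfile m s := by
  unfold carlemanProfile; positivity

lemma hasDerivAt_carlemanProfile (m : ℕ) {s : ℝ} (hs : s ≠ 0) :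
    HasDerivAt (carlemanProfile m) (-(carlemanProfile m s * (m * (2 - s) / s)) / 2) s := by
  have h1 := ((hasDerivAt_inv hs).pow m).mul
    (((hasDerivAt_id s).const_mul ((m : ℝ) / 2)).exp)
  refine h1.congr_deriv ?_
  simp only [carlemanProfile, id, Pi.pow_apply]
  rcases m with _ | m
  · simp
  · simp only [Nat.add_sub_cancel, inv_pow, pow_succ]
    field_simp
    ring

/-- The gradient of `p u`, where `p` is the Carleman weight. -/
noncomputable def weightedGrad (m : ℕ) (u : 𝔼 → ℝ) (u₁ : Fin n → 𝔼 → ℝ) (j : Fin n) (y : 𝔼) : ℝ :=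
  carlemanProfile m (sumSq y) * (u₁ j y - m * (2 - sumSq y) / sumSq y * (y j * u y))

/-- The vector field whose divergence appears in the pointwise Carleman inequality
for the Laplacian. -/
noncomputable def carlemanField (m : ℕ) (u : 𝔼 → ℝ) (u₁ : Fin n → 𝔼 → ℝ) (i : Fin n) (y : 𝔼) : ℝ :=
  2 * (2 * m * (2 - sumSq y) *
      ((∑ j, y j * weightedGrad m u u₁ j y) * weightedGrad m u u₁ i y))
    - 2 * m * (2 - sumSq y) *
      ((∑ j, weightedGrad m u u₁ j y * weightedGrad m u u₁ j y) * y i)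
    + 2 * m * ((n - 2) * (2 - sumSq y) - 4 * sumSq y) *
      (carlemanProfile m (sumSq y) * u y * weightedGrad m u u₁ i y)
    + ((2 * m) ^ 3 * (2 - sumSq y) ^ 3 / (4 * sumSq y) - 3 * (2 * m) ^ 2 * (2 - sumSq y)
        + (n + 2) * (2 * m)) *
      (carlemanProfile m (sumSq y) * u y * (carlemanProfile m (sumSq y) * u y) * y i)

/-- The algebraic inequality behind the pointwise Carleman estimate. -/
lemma carleman_algebraic {n τ s z A N G L : ℝ} (hn : 0 ≤ n) (hs : 0 < s) (hs1 : s ≤ 1)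
    (hτ : 2 * (n + 1) ≤ τ)
    (hL : L = G - τ * (2 - s) / s * A - ((τ * (2 - s)) ^ 2 / 4
      + (n - 2) / 2 * (τ * (2 - s)) - τ * s) * z / s) :
    2 * (τ * (2 - s)) * A * L + τ * ((n - 2) * (2 - s) - 4 * s) * z * L
        + 2 * (-2 * τ) * A ^ 2
        + ((2 - n) * (τ * (2 - s)) - (-2 * τ) * s + τ * ((n - 2) * (2 - s) - 4 * s)) * N
        + (-2 * τ * (n + 2) * z
          + 2 * (τ ^ 3 * (2 - s) ^ 3 / (4 * s) - 3 * τ ^ 2 * (2 - s) + (n + 2) * τ) * z) * A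
        + (2 * (-(3 * τ ^ 3 * (2 - s) ^ 2 / (4 * s)) - τ ^ 3 * (2 - s) ^ 3 / (4 * s ^ 2)
            + 3 * τ ^ 2) * s
          + n * (τ ^ 3 * (2 - s) ^ 3 / (4 * s) - 3 * τ ^ 2 * (2 - s) + (n + 2) * τ)) * z ^ 2
      + 2 * τ * s * N + τ ^ 3 / 4 * z ^ 2 ≤ 2 * s * G ^ 2 := by
  have hτ0 : 0 < τ := by linarith
  have hcoef : 0 ≤ τ * (τ * (2 - s)) ^ 2 / 2 + 6 * τ * (τ * (2 - s)) - 6 * τ ^ 2 * s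
      - n * (n + 2) * τ - τ ^ 3 / 4 := by
    have h1 : τ ≤ τ * (2 - s) := by nlinarith
    have h2 : τ ^ 2 ≤ (τ * (2 - s)) ^ 2 := by nlinarith
    have h3 : 4 * (n * (n + 2)) ≤ τ ^ 2 := by nlinarith
    have h4 := mul_le_mul_of_nonneg_left h2 hτ0.le
    have h5 := mul_le_mul_of_nonneg_left h3 hτ0.le
    have h6 := mul_le_mul_of_nonneg_left h1 hτ0.le
    have h7 : τ ^ 2 * s ≤ τ ^ 2 := by nlinarith
    nlinarith
  have hid : 2 * s * G ^ 2 - (2 * (τ * (2 - s)) * A * L + τ * ((n - 2) * (2 - s) - 4 * s) * z * L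
        + 2 * (-2 * τ) * A ^ 2
        + ((2 - n) * (τ * (2 - s)) - (-2 * τ) * s + τ * ((n - 2) * (2 - s) - 4 * s)) * N
        + (-2 * τ * (n + 2) * z
          + 2 * (τ ^ 3 * (2 - s) ^ 3 / (4 * s) - 3 * τ ^ 2 * (2 - s) + (n + 2) * τ) * z) * A
        + (2 * (-(3 * τ ^ 3 * (2 - s) ^ 2 / (4 * s)) - τ ^ 3 * (2 - s) ^ 3 / (4 * s ^ 2)
            + 3 * τ ^ 2) * s
          + n * (τ ^ 3 * (2 - s) ^ 3 / (4 * s) - 3 * τ ^ 2 * (2 - s) + (n + 2) * τ)) * z ^ 2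
      + 2 * τ * s * N + τ ^ 3 / 4 * z ^ 2) =
      (s * G - τ * (2 - s) * (A + (n - 2) / 2 * z)) ^ 2 / s + s * (G + 2 * τ * z) ^ 2
      + (τ * (2 - s) * (A + (n - 2) / 2 * z)) ^ 2 / s + 4 * τ * A ^ 2
      + (τ * (τ * (2 - s)) ^ 2 / 2 + 6 * τ * (τ * (2 - s)) - 6 * τ ^ 2 * s
      - n * (n + 2) * τ - τ ^ 3 / 4) * z ^ 2 := by
    rw [hL]; field_simp; ring
  have h8 := mul_nonneg hcoef (sq_nonneg z)
  have h9 : 0 ≤ (s * G - τ * (2 - s) * (A + (n - 2) / 2 * z)) ^ 2 / s + s * (G + 2 * τ * z) ^ 2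
      + (τ * (2 - s) * (A + (n - 2) / 2 * z)) ^ 2 / s + 4 * τ * A ^ 2 := by positivity
  linarith

lemma sumSq_eq_norm_sq (x : 𝔼) : sumSq x = ‖x‖ ^ 2 := by
  simp [sumSq, EuclideanSpace.norm_sq_eq]

lemma sumSq_pos {x : 𝔼} (hx : x ≠ 0) : 0 < sumSq x := by
  rw [sumSq_eq_norm_sq]; positivity

lemma hasLineDerivAt_carlemanProfile (m : ℕ) {x : 𝔼} (hx : x ≠ 0) (i : Fin n) :
    HasLineDerivAt ℝ (fun y => carlemanProfile m (sumSq y))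
      (-(carlemanProfile m (sumSq x) * (m * (2 - sumSq x) / sumSq x) * x i)) x (∂ₑ i) := by
  convert (hasDerivAt_carlemanProfile m (sumSq_pos hx).ne').comp_hasLineDerivAt
    (hasLineDerivAt_sumSq x i) using 1
  ring

lemma hasLineDerivAt_weightedGrad (m : ℕ) {u : 𝔼 → ℝ} {u₁ : Fin n → 𝔼 → ℝ} {x : 𝔼}
    (hx : x ≠ 0) {u₂ : Fin n → Fin n → ℝ}
    (hu : ∀ i, HasLineDerivAt ℝ u (u₁ i x) x (∂ₑ i))
    (hu₁ : ∀ i j, HasLineDerivAt ℝ (u₁ j) (u₂ i j) x (∂ₑ i)) (i j : Fin n) :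
    HasLineDerivAt ℝ (weightedGrad m u u₁ j)
      (carlemanProfile m (sumSq x) * (u₂ i j
        - m * (2 - sumSq x) / sumSq x * (x i * u₁ j x + x j * u₁ i x)
        + ((m * (2 - sumSq x) / sumSq x) ^ 2 + 4 * m / sumSq x ^ 2) * x i * x j * u x
        - m * (2 - sumSq x) / sumSq x * (if j = i then 1 else 0) * u x)) x (∂ₑ i) := by
  have hs := (sumSq_pos hx).ne'
  have hq : HasDerivAt (fun s : ℝ => m * (2 - s) / s) (-(2 * m / sumSq x ^ 2)) (sumSq x) := by
    refine ((((hasDerivAt_id (sumSq x)).const_sub 2).const_mul (m : ℝ)).fun_div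
      (hasDerivAt_id (sumSq x)) hs).congr_deriv ?_
    simp only [id]
    field_simp
    ring
  refine HasDerivAt.congr_deriv (HasLineDerivAt.fun_mul (hasLineDerivAt_carlemanProfile m hx i)
    ((hu₁ i j).fun_sub ((hq.comp_hasLineDerivAt (hasLineDerivAt_sumSq x i)).fun_mul
      ((hasLineDerivAt_coord x i j).fun_mul (hu i))))) ?_
  ring

set_option maxHeartbeats 2000000 in
/-- The pointwise Carleman inequality for the Laplacian. -/
lemma carleman_pointwise {m : ℕ} {u : 𝔼 → ℝ} {u₁ : Fin n → 𝔼 → ℝ} {x : 𝔼}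
    (hx : x ≠ 0) (hx1 : sumSq x ≤ 1) (hm : n + 1 ≤ m) {u₂ : Fin n → Fin n → ℝ}
    (hsymm : ∀ i j, u₂ i j = u₂ j i)
    (hu : ∀ i, HasLineDerivAt ℝ u (u₁ i x) x (∂ₑ i))
    (hu₁ : ∀ i j, HasLineDerivAt ℝ (u₁ j) (u₂ i j) x (∂ₑ i)) :
    ∃ D : Fin n → ℝ, (∀ i, HasLineDerivAt ℝ (carlemanField m u u₁ i) (D i) x (∂ₑ i)) ∧
      ∑ i, D i + carlemanProfile m (sumSq x) ^ 2 *
        (m / 8 * sumSq x * (∑ j, u₁ j x ^ 2) + m ^ 3 * u x ^ 2)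
      ≤ carlemanProfile m (sumSq x) ^ 2 * (2 * sumSq x * (∑ i, u₂ i i) ^ 2) := by
  have hs := sumSq_pos hx
  have hs0 := hs.ne'
  have hmR : (n : ℝ) + 1 ≤ m := by exact_mod_cast hm
  have hn0 : (0 : ℝ) ≤ n := n.cast_nonneg
  have hb : HasDerivAt (fun s : ℝ => 2 * m * (2 - s)) (-(2 * m)) (sumSq x) := by
    simpa using ((hasDerivAt_id (sumSq x)).const_sub 2).const_mul (2 * m : ℝ)
  have hc : HasDerivAt (fun s : ℝ => 2 * m * ((n - 2) * (2 - s) - 4 * s))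
      (-(2 * m * (n + 2))) (sumSq x) := by
    refine (((((hasDerivAt_id (sumSq x)).const_sub 2).const_mul ((n : ℝ) - 2)).fun_sub
      ((hasDerivAt_id (sumSq x)).const_mul 4)).const_mul (2 * m : ℝ)).congr_deriv ?_
    ring
  have hg : HasDerivAt (fun s : ℝ => (2 * m) ^ 3 * (2 - s) ^ 3 / (4 * s)
        - 3 * (2 * m) ^ 2 * (2 - s) + (n + 2) * (2 * m))
      (-(3 * (2 * m) ^ 3 * (2 - sumSq x) ^ 2 / (4 * sumSq x))
        - (2 * m) ^ 3 * (2 - sumSq x) ^ 3 / (4 * sumSq x ^ 2) + 3 * (2 * m) ^ 2) (sumSq x) := by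
    refine (((((((hasDerivAt_id (sumSq x)).const_sub 2).fun_pow 3).const_mul
      ((2 * m : ℝ) ^ 3)).fun_div ((hasDerivAt_id (sumSq x)).const_mul 4)
        (by simpa using hs0)).fun_sub
      (((hasDerivAt_id (sumSq x)).const_sub 2).const_mul (3 * (2 * m : ℝ) ^ 2))).add_const
      (((n : ℝ) + 2) * (2 * m))).congr_deriv ?_
    simp only [id]
    field_simp
    ring
  obtain ⟨D, hD, hsum⟩ := pohozaev_divergence (x := x)
    (b := fun y => 2 * m * (2 - sumSq y))
    (c := fun y => 2 * m * ((n - 2) * (2 - sumSq y) - 4 * sumSq y))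
    (g := fun y => (2 * m) ^ 3 * (2 - sumSq y) ^ 3 / (4 * sumSq y)
        - 3 * (2 * m) ^ 2 * (2 - sumSq y) + (n + 2) * (2 * m))
    (z := fun y => carlemanProfile m (sumSq y) * u y)
    (Z := weightedGrad m u u₁)
    (b₁ := -2 * (2 * m)) (c₁ := -2 * (2 * m) * (n + 2))
    (g₁ := 2 * (-(3 * (2 * m) ^ 3 * (2 - sumSq x) ^ 2 / (4 * sumSq x))
        - (2 * m) ^ 3 * (2 - sumSq x) ^ 3 / (4 * sumSq x ^ 2) + 3 * (2 * m) ^ 2))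
    (H := fun i j => carlemanProfile m (sumSq x) * (u₂ i j
        - m * (2 - sumSq x) / sumSq x * (x i * u₁ j x + x j * u₁ i x)
        + ((m * (2 - sumSq x) / sumSq x) ^ 2 + 4 * m / sumSq x ^ 2) * x i * x j * u x
        - m * (2 - sumSq x) / sumSq x * (if j = i then 1 else 0) * u x))
    (fun i j => by
      have : (if j = i then (1 : ℝ) else 0) = if i = j then 1 else 0 := by simp [eq_comm]
      rw [hsymm i j, this]; ring)
    (fun i => (hb.comp_hasLineDerivAt (hasLineDerivAt_sumSq x i)).congr_deriv (by ring))
    (fun i => (hc.comp_hasLineDerivAt (hasLineDerivAt_sumSq x i)).congr_deriv (by ring))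
    (fun i => (hg.comp_hasLineDerivAt (hasLineDerivAt_sumSq x i)).congr_deriv (by ring))
    (fun i => ((hasLineDerivAt_carlemanProfile m hx i).fun_mul (hu i)).congr_deriv (by
      simp only [weightedGrad]; ring))
    (fun i j => hasLineDerivAt_weightedGrad m hx hu hu₁ i j)
  refine ⟨D, hD, ?_⟩
  rw [hsum]
  have hxx : ∑ j, x j * x j = sumSq x := by simp [sumSq, sq]
  have htr : ∀ i, carlemanProfile m (sumSq x) * (u₂ i i
        - m * (2 - sumSq x) / sumSq x * (x i * u₁ i x + x i * u₁ i x)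
        + ((m * (2 - sumSq x) / sumSq x) ^ 2 + 4 * m / sumSq x ^ 2) * x i * x i * u x
        - m * (2 - sumSq x) / sumSq x * (if i = i then 1 else 0) * u x) =
      carlemanProfile m (sumSq x) * u₂ i i
        - carlemanProfile m (sumSq x) * (2 * (m * (2 - sumSq x) / sumSq x)) * (x i * u₁ i x)
        + carlemanProfile m (sumSq x) *
          ((m * (2 - sumSq x) / sumSq x) ^ 2 + 4 * m / sumSq x ^ 2) * u x * (x i * x i)
        - carlemanProfile m (sumSq x) * (m * (2 - sumSq x) / sumSq x) * u x := fun i => by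
    simp only [if_true]; ring
  have hA : ∑ j, x j * weightedGrad m u u₁ j x =
      carlemanProfile m (sumSq x) * (∑ j, x j * u₁ j x - m * (2 - sumSq x) * u x) := by
    have : ∀ j, x j * weightedGrad m u u₁ j x = carlemanProfile m (sumSq x) * (x j * u₁ j x)
        - carlemanProfile m (sumSq x) * (m * (2 - sumSq x) / sumSq x) * u x * (x j * x j) :=
      fun j => by simp only [weightedGrad]; ring
    simp only [this, Finset.sum_sub_distrib, ← Finset.mul_sum, hxx]
    field_simp
  have hgrad : sumSq x * (carlemanProfile m (sumSq x) ^ 2 * ∑ j, u₁ j x ^ 2) ≤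
      2 * sumSq x * (∑ j, weightedGrad m u u₁ j x * weightedGrad m u u₁ j x)
      + 8 * m ^ 2 * (carlemanProfile m (sumSq x) * u x) ^ 2 := by
    have h1 : ∀ j, carlemanProfile m (sumSq x) ^ 2 * u₁ j x ^ 2 ≤
        2 * (weightedGrad m u u₁ j x * weightedGrad m u u₁ j x)
        + 2 * (m * (2 - sumSq x) / sumSq x * (carlemanProfile m (sumSq x) * u x)) ^ 2
          * (x j * x j) := fun j => by
      have : carlemanProfile m (sumSq x) * u₁ j x = weightedGrad m u u₁ j x
          + m * (2 - sumSq x) / sumSq x * (carlemanProfile m (sumSq x) * u x) * x j := by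
        simp only [weightedGrad]; ring
      rw [← mul_pow, this]
      nlinarith [sq_nonneg (weightedGrad m u u₁ j x
        - m * (2 - sumSq x) / sumSq x * (carlemanProfile m (sumSq x) * u x) * x j)]
    have h2 := Finset.sum_le_sum fun j (_ : j ∈ Finset.univ) => h1 j
    simp only [Finset.sum_add_distrib, ← Finset.mul_sum, hxx] at h2
    have h3 := mul_le_mul_of_nonneg_left h2 hs.le
    have h4 : sumSq x * (2 * (m * (2 - sumSq x) / sumSq x *
        (carlemanProfile m (sumSq x) * u x)) ^ 2 * sumSq x) =
        2 * (2 - sumSq x) ^ 2 * (m ^ 2 * (carlemanProfile m (sumSq x) * u x) ^ 2) := by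
      field_simp
    have h5 : (2 - sumSq x) ^ 2 ≤ 4 := by nlinarith
    have h6 := mul_le_mul_of_nonneg_right h5
      (by positivity : 0 ≤ (m : ℝ) ^ 2 * (carlemanProfile m (sumSq x) * u x) ^ 2)
    linarith
  have hN : 0 ≤ ∑ j, weightedGrad m u u₁ j x * weightedGrad m u u₁ j x :=
    Finset.sum_nonneg fun j _ => mul_self_nonneg _
  have halg := carleman_algebraic (n := n) (τ := 2 * m) (s := sumSq x)
    (z := carlemanProfile m (sumSq x) * u x)
    (A := ∑ j, x j * weightedGrad m u u₁ j x)
    (N := ∑ j, weightedGrad m u u₁ j x * weightedGrad m u u₁ j x)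
    (G := carlemanProfile m (sumSq x) * ∑ i, u₂ i i) hn0 hs hx1 (by linarith) rfl
  have hL : ∑ i, carlemanProfile m (sumSq x) * (u₂ i i
        - m * (2 - sumSq x) / sumSq x * (x i * u₁ i x + x i * u₁ i x)
        + ((m * (2 - sumSq x) / sumSq x) ^ 2 + 4 * m / sumSq x ^ 2) * x i * x i * u x
        - m * (2 - sumSq x) / sumSq x * (if i = i then 1 else 0) * u x) =
      carlemanProfile m (sumSq x) * (∑ i, u₂ i i)
      - 2 * m * (2 - sumSq x) / sumSq x * (∑ j, x j * weightedGrad m u u₁ j x)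
      - ((2 * m * (2 - sumSq x)) ^ 2 / 4 + (n - 2) / 2 * (2 * m * (2 - sumSq x))
        - 2 * m * sumSq x) * (carlemanProfile m (sumSq x) * u x) / sumSq x := by
    rw [Finset.sum_congr rfl fun i _ => htr i, hA]
    simp only [Finset.sum_add_distrib, Finset.sum_sub_distrib, ← Finset.mul_sum, hxx,
      Finset.sum_const, Finset.card_univ, Fintype.card_fin, nsmul_eq_mul]
    field_simp
    ring
  rw [hL]
  have hm0 : (0 : ℝ) ≤ m := m.cast_nonneg
  have hg8 := mul_le_mul_of_nonneg_left hgrad (by positivity : (0 : ℝ) ≤ m / 8)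
  have hsN : 0 ≤ m * (sumSq x * ∑ j, weightedGrad m u u₁ j x * weightedGrad m u u₁ j x) := by
    positivity
  linarith [halg, hg8, hsN]

/-- The vector field whose divergence appears in the pointwise Carleman inequality
for the radial vector field. -/
noncomputable def radialField (m : ℕ) (v : 𝔼 → ℝ) (i : Fin n) (y : 𝔼) : ℝ :=
  sumSq y * (carlemanProfile m (sumSq y) * v y * (carlemanProfile m (sumSq y) * v y)) * y i

/-- The pointwise Carleman inequality for the radial vector field. -/
lemma radial_pointwise {m : ℕ} {v : 𝔼 → ℝ} {v₁ : Fin n → ℝ} {x : 𝔼}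
    (hx : x ≠ 0) (hx1 : sumSq x ≤ 1)
    (hv : ∀ i, HasLineDerivAt ℝ v (v₁ i) x (∂ₑ i)) :
    ∃ D : Fin n → ℝ, (∀ i, HasLineDerivAt ℝ (radialField m v i) (D i) x (∂ₑ i)) ∧
      ∑ i, D i + carlemanProfile m (sumSq x) ^ 2 *
        (sumSq x * ((2 * m - n - 3) * v x ^ 2))
      ≤ carlemanProfile m (sumSq x) ^ 2 * (sumSq x * (∑ i, x i * v₁ i) ^ 2) := by
  have hs := sumSq_pos hx
  have hz : ∀ i, HasLineDerivAt ℝ (fun y => carlemanProfile m (sumSq y) * v y) _ x (∂ₑ i) :=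
    fun i => (hasLineDerivAt_carlemanProfile m hx i).fun_mul (hv i)
  refine ⟨_, fun i => ((hasLineDerivAt_sumSq x i).fun_mul ((hz i).fun_mul (hz i))).fun_mul
    (hasLineDerivAt_coord x i i), ?_⟩
  set p := carlemanProfile m (sumSq x)
  have key : ∀ i, (2 * x i * (p * v x * (p * v x)) + sumSq x * (
        (-(p * (m * (2 - sumSq x) / sumSq x) * x i) * v x + p * v₁ i) * (p * v x) +
        p * v x * (-(p * (m * (2 - sumSq x) / sumSq x) * x i) * v x + p * v₁ i))) * x i +
      sumSq x * (p * v x * (p * v x)) * (if i = i then 1 else 0) =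
      p ^ 2 * v x ^ 2 * (2 - 2 * (m * (2 - sumSq x))) * (x i * x i)
        + 2 * sumSq x * p ^ 2 * v x * (x i * v₁ i) + sumSq x * p ^ 2 * v x ^ 2 := fun i => by
    simp only [if_true]; field_simp; ring
  have hxx : ∑ j, x j * x j = sumSq x := by simp [sumSq, sq]
  rw [Finset.sum_congr rfl fun i _ => key i]
  simp only [Finset.sum_add_distrib, ← Finset.mul_sum, hxx,
    Finset.sum_const, Finset.card_univ, Fintype.card_fin, nsmul_eq_mul]
  generalize ∑ i, x i * v₁ i = e
  have hps : 0 ≤ p ^ 2 * sumSq x := by positivity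
  have hm : (m : ℝ) ≤ m * (2 - sumSq x) := le_mul_of_one_le_right m.cast_nonneg (by linarith)
  nlinarith [mul_nonneg hps (sq_nonneg (v x - e)),
    mul_nonneg (mul_nonneg hps (sq_nonneg (v x))) (sub_nonneg.2 hm)]

lemma abs_coord_le {x : 𝔼} (hx1 : sumSq x ≤ 1) (j : Fin n) : |x j| ≤ 1 := by
  have : x j ^ 2 ≤ sumSq x :=
    Finset.single_le_sum (f := fun j => x j ^ 2) (fun j _ => sq_nonneg _) (Finset.mem_univ j)
  exact (sq_le_one_iff_abs_le_one _).1 (this.trans hx1)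

lemma abs_weightedGrad_le {m : ℕ} (hm : 1 ≤ m) {u : 𝔼 → ℝ} {u₁ : Fin n → 𝔼 → ℝ} {x : 𝔼}
    (hx : x ≠ 0) (hx1 : sumSq x ≤ 1) {Φ : ℝ} (hu : |u x| ≤ Φ) (hu₁ : ∀ j, |u₁ j x| ≤ Φ)
    (j : Fin n) :
    |weightedGrad m u u₁ j x| ≤ carlemanProfile m (sumSq x) * (2 * m / sumSq x * Φ) := by
  have hs := sumSq_pos hx
  have hp := carlemanProfile_pos m hs
  have hmR : (1 : ℝ) ≤ m := by exact_mod_cast hm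
  have hΦ : 0 ≤ Φ := (abs_nonneg _).trans hu
  rw [weightedGrad, abs_mul, abs_of_pos hp]
  refine mul_le_mul_of_nonneg_left ?_ hp.le
  have h1 : |m * (2 - sumSq x) / sumSq x * (x j * u x)| ≤ m * (2 - sumSq x) / sumSq x * Φ := by
    rw [abs_mul, abs_mul, abs_of_nonneg (div_nonneg (mul_nonneg (by linarith) (by linarith)) hs.le)]
    refine mul_le_mul_of_nonneg_left ?_
      (div_nonneg (mul_nonneg (by linarith) (by linarith)) hs.le)
    calc |x j| * |u x| ≤ 1 * Φ := mul_le_mul (abs_coord_le hx1 j) hu (abs_nonneg _) zero_le_one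
      _ = Φ := one_mul _
  calc _ ≤ |u₁ j x| + |m * (2 - sumSq x) / sumSq x * (x j * u x)| := abs_sub _ _
    _ ≤ m * Φ + m * (2 - sumSq x) / sumSq x * Φ := add_le_add ((hu₁ j).trans (by nlinarith)) h1
    _ = 2 * m / sumSq x * Φ := by field_simp; ring

lemma abs_carlemanField_le {m : ℕ} (hm : 1 ≤ m) {u : 𝔼 → ℝ} {u₁ : Fin n → 𝔼 → ℝ} {x : 𝔼}
    (hx : x ≠ 0) (hx1 : sumSq x ≤ 1) {Φ : ℝ} (hu : |u x| ≤ Φ) (hu₁ : ∀ j, |u₁ j x| ≤ Φ)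
    (i : Fin n) :
    |carlemanField m u u₁ i x| ≤
      (18 * n + 60) * m ^ 3 / sumSq x *
        (carlemanProfile m (sumSq x) * (2 * m / sumSq x * Φ)) ^ 2 := by
  have hs := sumSq_pos hx
  have hp := carlemanProfile_pos m hs
  have hmR : (1 : ℝ) ≤ m := by exact_mod_cast hm
  have hn0 : (0 : ℝ) ≤ n := n.cast_nonneg
  have hΦ : 0 ≤ Φ := (abs_nonneg _).trans hu
  have hZ := abs_weightedGrad_le hm hx hx1 hu hu₁
  have hz : |carlemanProfile m (sumSq x) * u x| ≤
      carlemanProfile m (sumSq x) * (2 * m / sumSq x * Φ) := by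
    rw [abs_mul, abs_of_pos hp]
    refine mul_le_mul_of_nonneg_left (hu.trans ?_) hp.le
    refine le_mul_of_one_le_left hΦ ?_
    rw [le_div_iff₀ hs]; linarith
  have hxj := abs_coord_le hx1
  generalize carlemanProfile m (sumSq x) * (2 * m / sumSq x * Φ) = T at *
  have hT : 0 ≤ T := (abs_nonneg _).trans hz
  have hA : |∑ j, x j * weightedGrad m u u₁ j x| ≤ n * T := by
    refine (Finset.abs_sum_le_sum_abs _ _).trans ?_
    refine (Finset.sum_le_card_nsmul _ _ T fun j _ => ?_).trans (by simp)
    rw [abs_mul]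
    exact (mul_le_mul (hxj j) (hZ j) (abs_nonneg _) zero_le_one).trans (one_mul T).le
  have hN : |∑ j, weightedGrad m u u₁ j x * weightedGrad m u u₁ j x| ≤ n * T ^ 2 := by
    refine (Finset.abs_sum_le_sum_abs _ _).trans ?_
    refine (Finset.sum_le_card_nsmul _ _ (T ^ 2) fun j _ => ?_).trans (by simp)
    rw [abs_mul, sq]
    exact mul_le_mul (hZ j) (hZ j) (abs_nonneg _) hT
  have hm2 : (m : ℝ) ≤ m ^ 3 / sumSq x := by
    rw [le_div_iff₀ hs]
    nlinarith [pow_le_pow_right₀ hmR (show 1 ≤ 3 by norm_num)]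
  have hm3 : (m : ℝ) ^ 2 ≤ m ^ 3 / sumSq x := by
    rw [le_div_iff₀ hs]
    nlinarith [pow_le_pow_right₀ hmR (show 2 ≤ 3 by norm_num), sq_nonneg (m : ℝ)]
  have hb : |2 * m * (2 - sumSq x)| ≤ 4 * (m : ℝ) := by
    rw [abs_of_nonneg (by nlinarith)]; nlinarith
  have hc : |2 * m * (((n : ℝ) - 2) * (2 - sumSq x) - 4 * sumSq x)| ≤ (4 * n + 16) * (m : ℝ) := by
    rw [abs_le]
    have h1 : ((n : ℝ) - 2) * (2 - sumSq x) - 4 * sumSq x ≤ 2 * n + 8 := by nlinarith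
    have h2 : -(2 * n + 8 : ℝ) ≤ ((n : ℝ) - 2) * (2 - sumSq x) - 4 * sumSq x := by nlinarith
    constructor <;> nlinarith
  have hg : |(2 * m) ^ 3 * (2 - sumSq x) ^ 3 / (4 * sumSq x)
      - 3 * (2 * m) ^ 2 * (2 - sumSq x) + (n + 2) * (2 * m)| ≤
      (2 * n + 44) * ((m : ℝ) ^ 3 / sumSq x) := by
    have h1 : (2 * m) ^ 3 * (2 - sumSq x) ^ 3 / (4 * sumSq x) ≤ 16 * ((m : ℝ) ^ 3 / sumSq x) := by
      have : (2 - sumSq x) ^ 3 ≤ 2 ^ 3 := pow_le_pow_left₀ (by linarith) (by linarith) 3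
      have h2 : (2 * m) ^ 3 * (2 - sumSq x) ^ 3 / (4 * sumSq x) =
          2 * ((m : ℝ) ^ 3 / sumSq x) * (2 - sumSq x) ^ 3 := by field_simp; ring
      rw [h2]
      have : (0 : ℝ) ≤ (m : ℝ) ^ 3 / sumSq x := by positivity
      nlinarith
    have h1' : 0 ≤ (2 * m) ^ 3 * (2 - sumSq x) ^ 3 / (4 * sumSq x) := by
      have : 0 ≤ 2 - sumSq x := by linarith
      positivity
    have h2 : 3 * (2 * m) ^ 2 * (2 - sumSq x) ≤ 24 * ((m : ℝ) ^ 3 / sumSq x) := by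
      nlinarith [sq_nonneg (m : ℝ)]
    have h2' : 0 ≤ 3 * (2 * (m : ℝ)) ^ 2 * (2 - sumSq x) :=
      mul_nonneg (by positivity) (by linarith)
    have h3 : (n + 2) * (2 * m) ≤ (2 * n + 4) * ((m : ℝ) ^ 3 / sumSq x) := by nlinarith
    have h3' : 0 ≤ ((n : ℝ) + 2) * (2 * m) := by positivity
    have h4 : 0 ≤ n * ((m : ℝ) ^ 3 / sumSq x) := by positivity
    have h5 : 0 ≤ ((m : ℝ) ^ 3 / sumSq x) := by positivity
    rw [abs_le]
    constructor <;> nlinarith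
  have e1 : |2 * (2 * m * (2 - sumSq x) *
      ((∑ j, x j * weightedGrad m u u₁ j x) * weightedGrad m u u₁ i x))| ≤
      2 * (4 * m * ((n * T) * T)) := by
    rw [abs_mul, abs_mul, abs_mul (∑ j, _), abs_two]
    gcongr
    exact hZ i
  have e2 : |2 * m * (2 - sumSq x) *
      ((∑ j, weightedGrad m u u₁ j x * weightedGrad m u u₁ j x) * x i)| ≤
      4 * m * ((n * T ^ 2) * 1) := by
    rw [abs_mul, abs_mul (∑ j, _)]
    gcongr
    exact hxj i
  have e3 : |2 * m * ((n - 2) * (2 - sumSq x) - 4 * sumSq x) *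
      (carlemanProfile m (sumSq x) * u x * weightedGrad m u u₁ i x)| ≤
      (4 * n + 16) * m * (T * T) := by
    rw [abs_mul, abs_mul (_ * u x)]
    gcongr
    exact hZ i
  have e4 : |((2 * m) ^ 3 * (2 - sumSq x) ^ 3 / (4 * sumSq x) - 3 * (2 * m) ^ 2 * (2 - sumSq x)
        + (n + 2) * (2 * m)) *
      (carlemanProfile m (sumSq x) * u x * (carlemanProfile m (sumSq x) * u x) * x i)| ≤
      (2 * n + 44) * ((m : ℝ) ^ 3 / sumSq x) * (T * T * 1) := by
    rw [abs_mul, abs_mul _ (x i), abs_mul (_ * u x)]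
    gcongr
    exact hxj i
  have hT2 : 0 ≤ T ^ 2 := sq_nonneg T
  calc |carlemanField m u u₁ i x| ≤ 2 * (4 * m * ((n * T) * T)) + 4 * m * ((n * T ^ 2) * 1)
        + (4 * n + 16) * m * (T * T) + (2 * n + 44) * ((m : ℝ) ^ 3 / sumSq x) * (T * T * 1) := by
        unfold carlemanField
        exact (abs_add_le _ _).trans (add_le_add ((abs_add_le _ _).trans
          (add_le_add ((abs_sub _ _).trans (add_le_add e1 e2)) e3)) e4)
    _ = (16 * n + 16) * T ^ 2 * m + (2 * n + 44) * T ^ 2 * ((m : ℝ) ^ 3 / sumSq x) := by ring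
    _ ≤ (16 * n + 16) * T ^ 2 * ((m : ℝ) ^ 3 / sumSq x)
        + (2 * n + 44) * T ^ 2 * ((m : ℝ) ^ 3 / sumSq x) := by gcongr
    _ = (18 * n + 60) * m ^ 3 / sumSq x * T ^ 2 := by ring

lemma abs_radialField_le {m : ℕ} (hm : 1 ≤ m) {v : 𝔼 → ℝ} {x : 𝔼}
    (hx : x ≠ 0) (hx1 : sumSq x ≤ 1) {Φ : ℝ} (hv : |v x| ≤ Φ) (i : Fin n) :
    |radialField m v i x| ≤
      m ^ 3 / sumSq x * (carlemanProfile m (sumSq x) * (2 * m / sumSq x * Φ)) ^ 2 := by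
  have hs := sumSq_pos hx
  have hp := carlemanProfile_pos m hs
  have hmR : (1 : ℝ) ≤ m := by exact_mod_cast hm
  have hΦ : 0 ≤ Φ := (abs_nonneg _).trans hv
  have hz : |carlemanProfile m (sumSq x) * v x| ≤
      carlemanProfile m (sumSq x) * (2 * m / sumSq x * Φ) := by
    rw [abs_mul, abs_of_pos hp]
    refine mul_le_mul_of_nonneg_left (hv.trans ?_) hp.le
    refine le_mul_of_one_le_left hΦ ?_
    rw [le_div_iff₀ hs]; linarith
  have hm3 : (1 : ℝ) ≤ m ^ 3 / sumSq x := by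
    rw [le_div_iff₀ hs]
    linarith [one_le_pow₀ hmR (n := 3)]
  generalize carlemanProfile m (sumSq x) * (2 * m / sumSq x * Φ) = T at *
  have hT : 0 ≤ T := (abs_nonneg _).trans hz
  rw [radialField, abs_mul, abs_mul, abs_mul (_ * v x), abs_of_pos hs]
  calc _ ≤ 1 * (T * T) * 1 := by
        gcongr
        exact abs_coord_le hx1 i
    _ ≤ m ^ 3 / sumSq x * T ^ 2 := by nlinarith [mul_self_nonneg T]

/-- The total vector field of the Carleman inequality for the coupled system. -/
noncomputable def systemField {d₁ d₂ : ℕ} (m : ℕ) (u : 𝔼 → EuclideanSpace ℝ (Fin d₁))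
    (v : 𝔼 → EuclideanSpace ℝ (Fin d₂)) (i : Fin n) (y : 𝔼) : ℝ :=
  ∑ c, carlemanField m (fun y => u y c) (fun j y => fderiv ℝ u y (∂ₑ j) c) i y
    + ∑ c, radialField m (fun y => v y c) i y

section System

variable {d₁ d₂ : ℕ} {u : EuclideanSpace ℝ (Fin n) → EuclideanSpace ℝ (Fin d₁)}
  {v : EuclideanSpace ℝ (Fin n) → EuclideanSpace ℝ (Fin d₂)}

lemma norm_fderiv_single_le (x : 𝔼) (j : Fin n) : ‖fderiv ℝ u x (∂ₑ j)‖ ≤ ‖fderiv ℝ u x‖ := by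
  simpa using (fderiv ℝ u x).le_opNorm (∂ₑ j)

lemma abs_systemField_le {m : ℕ} (hm : 1 ≤ m) {x : 𝔼} (hx : x ≠ 0) (hx1 : sumSq x ≤ 1)
    (i : Fin n) :
    |systemField m u v i x| ≤ 4 * (d₁ * (18 * n + 60) + d₂) * m ^ 5 / sumSq x ^ 3 *
      carlemanProfile m (sumSq x) ^ 2 * (‖u x‖ + ‖fderiv ℝ u x‖ + ‖v x‖) ^ 2 := by
  have hs := sumSq_pos hx
  set Φ := ‖u x‖ + ‖fderiv ℝ u x‖ + ‖v x‖ with hΦ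
  have h0 := norm_nonneg (u x)
  have h1 := norm_nonneg (fderiv ℝ u x)
  have h2 := norm_nonneg (v x)
  have hu : ∀ c, |u x c| ≤ Φ := fun c => by
    have := PiLp.norm_apply_le (u x) c
    rw [Real.norm_eq_abs] at this
    linarith
  have hv : ∀ c, |v x c| ≤ Φ := fun c => by
    have := PiLp.norm_apply_le (v x) c
    rw [Real.norm_eq_abs] at this
    linarith
  have hu₁ : ∀ c j, |fderiv ℝ u x (∂ₑ j) c| ≤ Φ := fun c j => by
    have := (PiLp.norm_apply_le (fderiv ℝ u x (∂ₑ j)) c).trans (norm_fderiv_single_le x j)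
    rw [Real.norm_eq_abs] at this
    linarith
  have e1 := (Finset.abs_sum_le_sum_abs _ _).trans (Finset.sum_le_card_nsmul Finset.univ _ _
    fun c _ => abs_carlemanField_le (u := fun y => u y c)
      (u₁ := fun j y => fderiv ℝ u y (∂ₑ j) c) hm hx hx1 (hu c) (hu₁ c) i)
  have e2 := (Finset.abs_sum_le_sum_abs _ _).trans (Finset.sum_le_card_nsmul Finset.univ _ _
    fun c _ => abs_radialField_le (v := fun y => v y c) hm hx hx1 (hv c) i)
  refine ((abs_add_le _ _).trans (add_le_add e1 e2)).trans_eq ?_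
  simp only [Finset.card_univ, Fintype.card_fin, nsmul_eq_mul]
  field_simp
  ring

lemma norm_fderiv_sq_le (x : 𝔼) :
    ‖fderiv ℝ u x‖ ^ 2 ≤ ∑ c, ∑ j, (fderiv ℝ u x (∂ₑ j) c) ^ 2 := by
  have hS : ∑ c, ∑ j, (fderiv ℝ u x (∂ₑ j) c) ^ 2 = ∑ j, ‖fderiv ℝ u x (∂ₑ j)‖ ^ 2 := by
    rw [Finset.sum_comm]
    simp [EuclideanSpace.norm_sq_eq]
  rw [hS]
  refine (Real.le_sqrt (norm_nonneg _) (Finset.sum_nonneg fun _ _ => sq_nonneg _)).1 ?_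
  refine ContinuousLinearMap.opNorm_le_bound _ (Real.sqrt_nonneg _) fun y => ?_
  have hy : y = ∑ j, y j • (∂ₑ j) := by
    ext k; simp [Finset.sum_apply, Pi.single_apply]
  calc ‖fderiv ℝ u x y‖ = ‖∑ j, y j • fderiv ℝ u x (∂ₑ j)‖ := by
        conv_lhs => rw [hy]
        simp [map_sum]
    _ ≤ ∑ j, ‖fderiv ℝ u x (∂ₑ j)‖ * ‖y j‖ := by
        refine (norm_sum_le _ _).trans_eq (Finset.sum_congr rfl fun j _ => ?_)
        rw [norm_smul, mul_comm]
    _ ≤ √(∑ j, ‖fderiv ℝ u x (∂ₑ j)‖ ^ 2) * √(∑ j, ‖y j‖ ^ 2) :=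
        Real.sum_mul_le_sqrt_mul_sqrt _ _ _
    _ = _ := by rw [← EuclideanSpace.norm_eq]

lemma contDiffAt_carlemanProfile (m : ℕ) {k : WithTop ℕ∞} {x : 𝔼} (hx : x ≠ 0) :
    ContDiffAt ℝ k (fun y : 𝔼 => carlemanProfile m (sumSq y)) x := by
  have hs : ∑ j, x j ^ 2 ≠ 0 := (sumSq_pos hx).ne'
  unfold carlemanProfile sumSq
  fun_prop (disch := exact hs)

lemma contDiffAt_systemField (m : ℕ) {x : 𝔼} (hx : x ≠ 0) (hu : ContDiffAt ℝ 2 u x)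
    (hv : ContDiffAt ℝ 1 v x) (i : Fin n) : ContDiffAt ℝ 1 (systemField m u v i) x := by
  have hs : ∑ j, x j ^ 2 ≠ 0 := (sumSq_pos hx).ne'
  have hs4 : 4 * ∑ j, x j ^ 2 ≠ 0 := mul_ne_zero four_ne_zero hs
  have hp := contDiffAt_carlemanProfile m (k := 1) hx
  have hs' : ContDiffAt ℝ 1 (sumSq : 𝔼 → ℝ) x := by unfold sumSq; fun_prop
  have hsn := (sumSq_pos hx).ne'
  have hsn4 : 4 * sumSq x ≠ 0 := mul_ne_zero four_ne_zero hsn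
  have hu1 : ContDiffAt ℝ 1 u x := hu.of_le one_le_two
  have hu' : ContDiffAt ℝ 1 (fderiv ℝ u) x := hu.fderiv_right (by norm_num)
  have hZ : ∀ c j, ContDiffAt ℝ 1 (weightedGrad m (fun y => u y c)
      (fun j y => fderiv ℝ u y (∂ₑ j) c) j) x := fun c j => by
    unfold weightedGrad
    fun_prop (disch := assumption)
  unfold systemField carlemanField radialField
  fun_prop (disch := assumption)

lemma HasFDerivAt.hasLineDerivAt_apply {d : ℕ} {f : 𝔼 → EuclideanSpace ℝ (Fin d)}
    {f' : 𝔼 →L[ℝ] EuclideanSpace ℝ (Fin d)} {x : 𝔼} (hf : HasFDerivAt f f' x) (c : Fin d)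
    (w : 𝔼) : HasLineDerivAt ℝ (fun y => f y c) (f' w c) x w :=
  ((EuclideanSpace.proj (𝕜 := ℝ) c).hasFDerivAt.comp x hf).hasLineDerivAt w

/-- The lower order terms of the coupled system are absorbed by the Carleman weights. -/
lemma carleman_absorption {n m C s α β W a b : ℝ} (hn0 : 0 ≤ n) (hmn' : n + 4 ≤ m)
    (hmC : 8 * (9 * C ^ 2 + 1) ≤ m) (hs : 0 < s) (hx1 : s ≤ 1)
    (hu2 : 0 ≤ α) (hv2 : 0 ≤ β) (hW : 0 ≤ W)
    (h1 : a ≤ 3 * C ^ 2 * (α + W + β)) (h2 : b ≤ 3 * C ^ 2 * (α + W + β)) :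
    2 * s * a + s * b + s * (α + β) ≤
      m / 8 * s * W + m ^ 3 * α + s * ((2 * m - n - 3) * β) := by
  have hm0 : 0 ≤ m := by linarith
  have hm3 : m ≤ m ^ 3 := le_self_pow₀ (by linarith) (by norm_num)
  have k1 : (9 * C ^ 2) * (s * (α + W + β)) + s * (α + β) ≤
      m / 8 * (s * W) + m * (s * α) + (2 * m - n - 3) * (s * β) := by
    have hα := mul_nonneg hs.le hu2
    have hβ := mul_nonneg hs.le hv2
    have hWs := mul_nonneg hs.le hW
    have j1 : (9 * C ^ 2) * (s * W) ≤ m / 8 * (s * W) :=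
      mul_le_mul_of_nonneg_right (by linarith) hWs
    have j2 : (9 * C ^ 2 + 1) * (s * α) ≤ m * (s * α) :=
      mul_le_mul_of_nonneg_right (by nlinarith [sq_nonneg C]) hα
    have j3 : (9 * C ^ 2 + 1) * (s * β) ≤ (2 * m - n - 3) * (s * β) :=
      mul_le_mul_of_nonneg_right (by nlinarith [sq_nonneg C]) hβ
    nlinarith
  have k2 : m * (s * α) ≤ m ^ 3 * α := by
    have : s * α ≤ α := mul_le_of_le_one_left hu2 hx1
    calc m * (s * α) ≤ m * α := by gcongr
      _ ≤ m ^ 3 * α := by gcongr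
  have k3 := mul_le_mul_of_nonneg_left h1 hs.le
  have k4 := mul_le_mul_of_nonneg_left h2 hs.le
  nlinarith

set_option maxHeartbeats 1000000 in
/-- The pointwise divergence inequality for solutions of the coupled differential inequalities. -/
lemma systemField_divergence_le {m : ℕ} {x : 𝔼} {C : ℝ}
    (hx : x ≠ 0) (hx1 : sumSq x ≤ 1) (hmn : n + 4 ≤ m) (hmC : 8 * (9 * C ^ 2 + 1) ≤ m)
    (hu : ContDiffAt ℝ 2 u x) (hv : ContDiffAt ℝ 1 v x)
    (hpde : ‖lapV u x‖ ≤ C * (‖u x‖ + ‖fderiv ℝ u x‖ + ‖v x‖))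
    (hode : ‖fderiv ℝ v x x‖ ≤ C * (‖v x‖ + ‖u x‖ + ‖fderiv ℝ u x‖)) :
    ∑ i, fderiv ℝ (systemField m u v i) x (∂ₑ i)
      + carlemanProfile m (sumSq x) ^ 2 * (sumSq x * (‖u x‖ ^ 2 + ‖v x‖ ^ 2)) ≤ 0 := by
  have hs := sumSq_pos hx
  have hu' : HasFDerivAt u (fderiv ℝ u x) x := (hu.differentiableAt two_ne_zero).hasFDerivAt
  have hv' : HasFDerivAt v (fderiv ℝ v x) x := (hv.differentiableAt one_ne_zero).hasFDerivAt
  have hu'' : HasFDerivAt (fderiv ℝ u) (fderiv ℝ (fderiv ℝ u) x) x :=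
    ((hu.fderiv_right (m := 1) (by norm_num)).differentiableAt one_ne_zero).hasFDerivAt
  have hsymm : ∀ a b, fderiv ℝ (fderiv ℝ u) x a b = fderiv ℝ (fderiv ℝ u) x b a :=
    fun a b => (hu.isSymmSndFDerivAt (by simp)) a b
  have hu₁ : ∀ c (i j : Fin n), HasLineDerivAt ℝ (fun y => fderiv ℝ u y (∂ₑ j) c)
      (fderiv ℝ (fderiv ℝ u) x (∂ₑ i) (∂ₑ j) c) x (∂ₑ i) := fun c i j => by
    have := (hu''.clm_apply (hasFDerivAt_const (∂ₑ j) x)).hasLineDerivAt_apply c (∂ₑ i)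
    simpa using this
  choose D₁ hD₁ hD₁s using fun c => carleman_pointwise (m := m) (u := fun y => u y c)
    (u₁ := fun j y => fderiv ℝ u y (∂ₑ j) c) hx hx1 (by omega)
    (u₂ := fun i j => fderiv ℝ (fderiv ℝ u) x (∂ₑ i) (∂ₑ j) c)
    (fun i j => by rw [hsymm]) (fun i => hu'.hasLineDerivAt_apply c _) (hu₁ c)
  choose D₂ hD₂ hD₂s using fun c => radial_pointwise (m := m) (v := fun y => v y c) hx hx1
    (fun i => hv'.hasLineDerivAt_apply c (∂ₑ i))
  have hdiv : ∀ i, fderiv ℝ (systemField m u v i) x (∂ₑ i) = ∑ c, D₁ c i + ∑ c, D₂ c i := by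
    intro i
    have h1 : HasLineDerivAt ℝ (systemField m u v i) _ x (∂ₑ i) :=
      (HasLineDerivAt.fun_sum (s := Finset.univ) fun c _ => hD₁ c i).fun_add
        (HasLineDerivAt.fun_sum (s := Finset.univ) fun c _ => hD₂ c i)
    exact (((contDiffAt_systemField m hx hu hv i).differentiableAt
      one_ne_zero).hasFDerivAt.hasLineDerivAt (∂ₑ i)).unique h1
  have hlap : ∑ c, (∑ i, fderiv ℝ (fderiv ℝ u) x (∂ₑ i) (∂ₑ i) c) ^ 2 = ‖lapV u x‖ ^ 2 := by
    rw [EuclideanSpace.norm_sq_eq]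
    refine Finset.sum_congr rfl fun c _ => ?_
    simp [lapV, iteratedFDeriv_two_apply]
  have hrad : ∑ c, (∑ i, x i * fderiv ℝ v x (∂ₑ i) c) ^ 2 = ‖fderiv ℝ v x x‖ ^ 2 := by
    rw [EuclideanSpace.norm_sq_eq]
    refine Finset.sum_congr rfl fun c _ => ?_
    have hy : x = ∑ j, x j • (∂ₑ j) := by
      ext k; simp [Finset.sum_apply, Pi.single_apply]
    have : fderiv ℝ v x x = ∑ j, x j • fderiv ℝ v x (∂ₑ j) := by
      calc fderiv ℝ v x x = fderiv ℝ v x (∑ j, x j • (∂ₑ j)) := congrArg _ hy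
        _ = _ := by simp
    rw [this]
    simp
  have hsu : ∑ c, u x c ^ 2 = ‖u x‖ ^ 2 := by simp [EuclideanSpace.norm_sq_eq]
  have hsv : ∑ c, v x c ^ 2 = ‖v x‖ ^ 2 := by simp [EuclideanSpace.norm_sq_eq]
  have hDu := norm_fderiv_sq_le (u := u) x
  have hS₁ := Finset.sum_le_sum fun c (_ : c ∈ Finset.univ) => hD₁s c
  have hS₂ := Finset.sum_le_sum fun c (_ : c ∈ Finset.univ) => hD₂s c
  simp only [Finset.sum_add_distrib, ← Finset.mul_sum, hlap, hrad, hsu, hsv] at hS₁ hS₂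
  have hdiv' : ∑ i, fderiv ℝ (systemField m u v i) x (∂ₑ i) =
      ∑ c, ∑ i, D₁ c i + ∑ c, ∑ i, D₂ c i := by
    simp only [hdiv, Finset.sum_add_distrib]
    rw [Finset.sum_comm, Finset.sum_comm (f := fun i c => D₂ c i)]
  rw [hdiv']
  generalize ∑ c, ∑ j, (fderiv ℝ u x (∂ₑ j) c) ^ 2 = W at *
  generalize ‖fderiv ℝ u x‖ = w at *
  have h1 : ‖lapV u x‖ ^ 2 ≤ 3 * C ^ 2 * (‖u x‖ ^ 2 + W + ‖v x‖ ^ 2) := by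
    have := pow_le_pow_left₀ (norm_nonneg _) hpde 2
    have h3 : (‖u x‖ + w + ‖v x‖) ^ 2 ≤ 3 * (‖u x‖ ^ 2 + W + ‖v x‖ ^ 2) := by
      nlinarith [sq_nonneg (‖u x‖ - w), sq_nonneg (‖u x‖ - ‖v x‖), sq_nonneg (w - ‖v x‖)]
    nlinarith [mul_le_mul_of_nonneg_left h3 (sq_nonneg C)]
  have h2 : ‖fderiv ℝ v x x‖ ^ 2 ≤ 3 * C ^ 2 * (‖u x‖ ^ 2 + W + ‖v x‖ ^ 2) := by
    have := pow_le_pow_left₀ (norm_nonneg _) hode 2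
    have h3 : (‖v x‖ + ‖u x‖ + w) ^ 2 ≤ 3 * (‖u x‖ ^ 2 + W + ‖v x‖ ^ 2) := by
      nlinarith [sq_nonneg (‖u x‖ - w), sq_nonneg (‖u x‖ - ‖v x‖), sq_nonneg (w - ‖v x‖)]
    nlinarith [mul_le_mul_of_nonneg_left h3 (sq_nonneg C)]
  have hW : 0 ≤ W := (sq_nonneg w).trans hDu
  generalize ‖lapV u x‖ ^ 2 = a at *
  generalize ‖fderiv ℝ v x x‖ ^ 2 = b at *
  have hu2 := sq_nonneg ‖u x‖
  have hv2 := sq_nonneg ‖v x‖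
  generalize ‖u x‖ ^ 2 = α at *
  generalize ‖v x‖ ^ 2 = β at *
  have hp2 := sq_nonneg (carlemanProfile m (sumSq x))
  generalize carlemanProfile m (sumSq x) ^ 2 = P at *
  generalize sumSq x = s at *
  have hmain := carleman_absorption n.cast_nonneg (n := (n : ℝ)) (by exact_mod_cast hmn) hmC hs hx1
    hu2 hv2 hW h1 h2
  have := mul_le_mul_of_nonneg_left hmain hp2
  nlinarith

end System

end Pohozaev

/-- A smooth function all of whose derivatives vanish at the origin is `O(‖x‖ ^ N)` there. -/
lemma exists_eventually_norm_le_of_flat {E : Type} [NormedAddCommGroup E] [NormedSpace ℝ E]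
    (N : ℕ) : ∀ {F : Type} [NormedAddCommGroup F] [NormedSpace ℝ F] {f : E → F},
    ContDiffAt ℝ (⊤ : ℕ∞) f 0 → (∀ k : ℕ, iteratedFDeriv ℝ k f 0 = 0) →
    ∃ K, 0 ≤ K ∧ ∀ᶠ x in nhds (0 : E), ‖f x‖ ≤ K * ‖x‖ ^ N := by
  have hval : ∀ {F : Type} [NormedAddCommGroup F] [NormedSpace ℝ F] {f : E → F},
      (∀ k : ℕ, iteratedFDeriv ℝ k f 0 = 0) → f 0 = 0 := fun h => by
    simpa using congrArg norm (h 0)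
  induction N with
  | zero =>
    intro F _ _ f hf h0
    refine ⟨1, zero_le_one, ?_⟩
    have h1 : Filter.Tendsto (fun x => ‖f x‖) (nhds 0) (nhds 0) := by
      have := hf.continuousAt.norm.tendsto
      simpa only [hval h0, norm_zero] using this
    filter_upwards [h1.eventually (gt_mem_nhds zero_lt_one)] with x hx
    simpa using hx.le
  | succ N ih =>
    intro F _ _ f hf h0
    have hf' : ContDiffAt ℝ (⊤ : ℕ∞) (fderiv ℝ f) 0 := hf.fderiv_right le_rfl
    obtain ⟨K, hK, hev⟩ := ih hf' fun k => by
      rw [← norm_eq_zero, norm_iteratedFDeriv_fderiv, h0, norm_zero]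
    refine ⟨K, hK, ?_⟩
    have hd : ∀ᶠ x in nhds (0 : E), DifferentiableAt ℝ f x :=
      ((hf.of_le (by simp : (1 : WithTop ℕ∞) ≤ (⊤ : ℕ∞))).eventually (by simp)).mono
        fun x hx => hx.differentiableAt one_ne_zero
    obtain ⟨r, hr, hball⟩ := Metric.eventually_nhds_iff_ball.1 (hev.and hd)
    filter_upwards [Metric.ball_mem_nhds (0 : E) hr] with x hx
    have hsub : ∀ y ∈ closedBall (0 : E) ‖x‖, y ∈ ball (0 : E) r := fun y hy => by
      rw [mem_closedBall_zero_iff] at hy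
      rw [mem_ball_zero_iff] at hx ⊢
      exact hy.trans_lt hx
    have h2 := (convex_closedBall (0 : E) ‖x‖).norm_image_sub_le_of_norm_fderiv_le
      (f := f) (C := K * ‖x‖ ^ N) (fun y hy => (hball y (hsub y hy)).2)
      (fun y hy => (hball y (hsub y hy)).1.trans (by
        rw [mem_closedBall_zero_iff] at hy
        gcongr))
      (mem_closedBall_self (norm_nonneg x)) (mem_closedBall_zero_iff.2 le_rfl)
    rw [hval h0, sub_zero, sub_zero] at h2
    rwa [pow_succ, ← mul_assoc]

section Cutoff

variable {n : ℕ}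

/-- Integration of a divergence inequality against a nonnegative cutoff function. -/
lemma integral_cutoff_mul_le {O : Set (EuclideanSpace ℝ (Fin n))}
    {V : Fin n → EuclideanSpace ℝ (Fin n) → ℝ} {Q θ : EuclideanSpace ℝ (Fin n) → ℝ}
    (hV : ∀ i, ∀ x ∈ O, ContDiffAt ℝ 1 (V i) x) (hQ : ∀ x ∈ O, ContinuousAt Q x)
    (hdiv : ∀ x ∈ O, ∑ i, fderiv ℝ (V i) x (EuclideanSpace.single i 1) + Q x ≤ 0)
    (hθ : ContDiff ℝ 1 θ) (hθc : HasCompactSupport θ) (hθO : tsupport θ ⊆ O) (hθ0 : ∀ x, 0 ≤ θ x) :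
    Integrable (fun x => θ x * Q x) ∧
      ∫ x, θ x * Q x ≤ ∫ x, ∑ i, fderiv ℝ θ x (EuclideanSpace.single i 1) * V i x := by
  have hint : ∀ {a b : EuclideanSpace ℝ (Fin n) → ℝ}, Continuous a → tsupport a ⊆ tsupport θ →
      (∀ x ∈ O, ContinuousAt b x) → Integrable (fun x => a x * b x) := by
    intro a b ha hsub hb
    have hac : HasCompactSupport a := hθc.of_isClosed_subset (isClosed_tsupport a) hsub
    refine Continuous.integrable_of_hasCompactSupport ?_ hac.mul_right
    refine continuous_iff_continuousAt.2 fun x => ?_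
    by_cases hx : x ∈ tsupport a
    · exact ha.continuousAt.mul (hb x (hθO (hsub hx)))
    · have h0 : (fun y => a y * b y) =ᶠ[nhds x] fun _ => 0 := by
        filter_upwards [(notMem_tsupport_iff_eventuallyEq.1 hx)] with y hy
        simp [hy]
      exact continuousAt_const.congr h0.symm
  have hdθ : ∀ i : Fin n, Continuous fun x => fderiv ℝ θ x (EuclideanSpace.single i 1) :=
    fun i => (hθ.continuous_fderiv one_ne_zero).clm_apply continuous_const
  have hI1 : ∀ i, Integrable fun x => fderiv ℝ θ x (EuclideanSpace.single i 1) * V i x :=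
    fun i => hint (hdθ i) (tsupport_fderiv_apply_subset ℝ _) fun x hx => (hV i x hx).continuousAt
  have hI2 : ∀ i, Integrable fun x => θ x * fderiv ℝ (V i) x (EuclideanSpace.single i 1) :=
    fun i => hint hθ.continuous subset_rfl fun x hx =>
      ((hV i x hx).fderiv_right (m := 0) (by simp)).continuousAt.clm_apply continuousAt_const
  have hI3 : ∀ i, Integrable fun x => θ x * V i x :=
    fun i => hint hθ.continuous subset_rfl fun x hx => (hV i x hx).continuousAt
  have hIQ : Integrable fun x => θ x * Q x := hint hθ.continuous subset_rfl hQ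
  refine ⟨hIQ, ?_⟩
  have hparts : ∀ i, ∫ x, fderiv ℝ θ x (EuclideanSpace.single i 1) * V i x =
      -∫ x, θ x * fderiv ℝ (V i) x (EuclideanSpace.single i 1) := fun i => by
    rw [integral_mul_fderiv_eq_neg_fderiv_mul_of_integrable (hI1 i) (hI2 i) (hI3 i)
      (fun x _ => hθ.differentiable one_ne_zero x)
      (fun x hx => (hV i x (hθO hx)).differentiableAt one_ne_zero), neg_neg]
  rw [integral_finsetSum _ fun i _ => hI1 i, Finset.sum_congr rfl fun i _ => hparts i,
    Finset.sum_neg_distrib, ← integral_finsetSum _ fun i _ => hI2 i, ← integral_neg]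
  refine integral_mono hIQ (integrable_finsetSum _ fun i _ => hI2 i).neg fun x => ?_
  by_cases hx : x ∈ tsupport θ
  · have := mul_le_mul_of_nonneg_left (hdiv x (hθO hx)) (hθ0 x)
    simp only [← Finset.mul_sum]
    linarith
  · simp [image_eq_zero_of_notMem_tsupport hx]

/-- Radial cutoff functions supported in an annulus, with gradient bounds. -/
lemma exists_annular_cutoff {R₁ R : ℝ} (hR₁ : 0 < R₁) (hR : R₁ < R) :
    ∃ M, 0 ≤ M ∧ ∀ δ, 0 < δ → 2 * δ < R₁ → ∃ θ : EuclideanSpace ℝ (Fin n) → ℝ,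
      ContDiff ℝ 1 θ ∧ tsupport θ ⊆ closedBall 0 R \ {0} ∧ (∀ x, 0 ≤ θ x) ∧
      (∀ x, 2 * δ ≤ ‖x‖ → ‖x‖ ≤ R₁ → θ x = 1) ∧ (∀ x, R₁ ≤ ‖x‖ → ‖fderiv ℝ θ x‖ ≤ M) ∧
      (∀ x, ‖x‖ ≤ 2 * δ → ‖fderiv ℝ θ x‖ ≤ M / δ) := by
  let χ : ContDiffBump (0 : EuclideanSpace ℝ (Fin n)) := ⟨R₁, R, hR₁, hR⟩
  let ψ : ContDiffBump (0 : EuclideanSpace ℝ (Fin n)) := ⟨1, 2, one_pos, one_lt_two⟩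
  have hχ : ContDiff ℝ 1 χ := χ.contDiff
  have hψ : ContDiff ℝ 1 ψ := ψ.contDiff
  obtain ⟨M₁, hM₁⟩ := χ.hasCompactSupport.fderiv ℝ |>.exists_bound_of_continuous
    (hχ.continuous_fderiv one_ne_zero)
  obtain ⟨M₂, hM₂⟩ := ψ.hasCompactSupport.fderiv ℝ |>.exists_bound_of_continuous
    (hψ.continuous_fderiv one_ne_zero)
  refine ⟨max M₁ M₂, ((norm_nonneg _).trans (hM₁ 0)).trans (le_max_left _ _), fun δ hδ hδR => ?_⟩
  have hscale : ∀ x : EuclideanSpace ℝ (Fin n), ‖δ⁻¹ • x‖ = ‖x‖ / δ := fun x => by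
    rw [norm_smul, norm_inv, Real.norm_of_nonneg hδ.le, div_eq_inv_mul]
  have hψ0 : ∀ x : EuclideanSpace ℝ (Fin n), 2 * δ ≤ ‖x‖ → ψ (δ⁻¹ • x) = 0 := fun x hx =>
    ψ.zero_of_le_dist (by rw [dist_zero_right, hscale, le_div_iff₀ hδ]; exact hx)
  have hψ1 : ∀ x : EuclideanSpace ℝ (Fin n), ‖x‖ ≤ δ → ψ (δ⁻¹ • x) = 1 := fun x hx =>
    ψ.one_of_mem_closedBall (by
      rw [mem_closedBall_zero_iff, hscale, div_le_iff₀ hδ]; simpa [ψ] using hx)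
  have hχ1 : ∀ x : EuclideanSpace ℝ (Fin n), ‖x‖ ≤ R₁ → χ x = 1 := fun x hx =>
    χ.one_of_mem_closedBall (mem_closedBall_zero_iff.2 hx)
  have hψs : ContDiff ℝ 1 fun x => ψ (δ⁻¹ • x) := hψ.comp (contDiff_const_smul _)
  refine ⟨fun x => χ x * (1 - ψ (δ⁻¹ • x)), hχ.mul (contDiff_const.sub hψs), ?_, fun x => ?_,
    fun x h1 h2 => ?_, fun x hx => ?_, fun x hx => ?_⟩
  · refine Set.subset_sdiff_singleton ?_ ?_
    · exact (tsupport_mul_subset_left).trans χ.tsupport_eq.subset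
    · rw [notMem_tsupport_iff_eventuallyEq]
      filter_upwards [Metric.closedBall_mem_nhds (0 : EuclideanSpace ℝ (Fin n)) hδ] with x hx
      simp [hψ1 x (mem_closedBall_zero_iff.1 hx)]
  · exact mul_nonneg χ.nonneg (sub_nonneg.2 ψ.le_one)
  · simp [hχ1 x h2, hψ0 x h1]
  · have h : (fun x => χ x * (1 - ψ (δ⁻¹ • x))) =ᶠ[nhds x] χ := by
      filter_upwards [(continuous_norm.tendsto x).eventually (lt_mem_nhds (hδR.trans_le hx))]
        with y hy
      simp [hψ0 y hy.le]
    rw [h.fderiv_eq]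
    exact (hM₁ x).trans (le_max_left _ _)
  · have h : (fun x => χ x * (1 - ψ (δ⁻¹ • x))) =ᶠ[nhds x] fun x => 1 - ψ (δ⁻¹ • x) := by
      filter_upwards [(continuous_norm.tendsto x).eventually (gt_mem_nhds (hx.trans_lt hδR))]
        with y hy
      simp [hχ1 y hy.le]
    have hd : fderiv ℝ (fun x => ψ (δ⁻¹ • x)) x = δ⁻¹ • fderiv ℝ ψ (δ⁻¹ • x) :=
      fderiv_comp_smul _
    rw [h.fderiv_eq, fderiv_const_sub, norm_neg, hd, norm_smul, norm_inv,
      Real.norm_of_nonneg hδ.le, ← div_eq_inv_mul]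
    gcongr
    exact (hM₂ _).trans (le_max_right _ _)

/-- A divergence inequality on a punctured ball for a field that decays at the origin controls
the zeroth order term by the size of the field near the boundary. -/
lemma exists_cutoff_estimate {R₁ R : ℝ} (hR₁ : 0 < R₁) (hR : R₁ < R) :
    ∃ A, ∀ (V : Fin n → EuclideanSpace ℝ (Fin n) → ℝ) (Q : EuclideanSpace ℝ (Fin n) → ℝ)
      (B₀ B₁ q : ℝ) (S : Set (EuclideanSpace ℝ (Fin n))), 0 ≤ B₀ → 0 ≤ B₁ →
      (∀ i x, x ≠ 0 → ‖x‖ ≤ R → ContDiffAt ℝ 1 (V i) x) →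
      (∀ x, x ≠ 0 → ‖x‖ ≤ R → ContinuousAt Q x) →
      (∀ x, x ≠ 0 → ‖x‖ ≤ R →
        ∑ i, fderiv ℝ (V i) x (EuclideanSpace.single i 1) + Q x ≤ 0) →
      (∀ x, x ≠ 0 → ‖x‖ ≤ R → 0 ≤ Q x) →
      (∀ᶠ x in nhdsWithin 0 {0}ᶜ, ∀ i, |V i x| ≤ B₀ * ‖x‖ ^ 2) →
      (∀ i x, R₁ ≤ ‖x‖ → ‖x‖ ≤ R → |V i x| ≤ B₁) →
      MeasurableSet S → (∃ ε > 0, ∀ x ∈ S, ε ≤ ‖x‖ ∧ ‖x‖ ≤ R₁ ∧ q ≤ Q x) →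
      q * volume.real S ≤ A * B₁ := by
  obtain ⟨M, hM, hcut⟩ := exists_annular_cutoff (n := n) hR₁ hR
  refine ⟨n * M * volume.real (closedBall (0 : EuclideanSpace ℝ (Fin n)) R), ?_⟩
  intro V Q B₀ B₁ q S hB₀ hB₁ hV hQ hdiv hQ0 hin hout hS ⟨ε, hε, hSε⟩
  set vol := volume.real (closedBall (0 : EuclideanSpace ℝ (Fin n)) R) with hvol
  have hvol0 : 0 ≤ vol := measureReal_nonneg
  obtain ⟨r, hr, hball⟩ := Metric.eventually_nhds_iff_ball.1 (eventually_nhdsWithin_iff.1 hin)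
  have key : ∀ δ, 0 < δ → 2 * δ < min R₁ (min ε r) →
      q * volume.real S ≤ n * M * vol * B₁ + δ * (n * (4 * M * B₀) * vol) := by
    intro δ hδ hδr
    have hδR : 2 * δ < R₁ := hδr.trans_le (min_le_left _ _)
    have hδε : 2 * δ < ε := hδr.trans_le ((min_le_right _ _).trans (min_le_left _ _))
    have hδr' : 2 * δ < r := hδr.trans_le ((min_le_right _ _).trans (min_le_right _ _))
    obtain ⟨θ, hθ, hθO, hθ0, hθ1, hθout, hθin⟩ := hcut δ hδ hδR
    have hθc : HasCompactSupport θ :=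
      (isCompact_closedBall 0 R).of_isClosed_subset (isClosed_tsupport θ)
        (hθO.trans Set.sdiff_subset)
    obtain ⟨hint, hle⟩ := integral_cutoff_mul_le (O := closedBall 0 R \ {0}) (V := V) (Q := Q)
      (θ := θ)
      (fun i x hx => hV i x hx.2 (mem_closedBall_zero_iff.1 hx.1))
      (fun x hx => hQ x hx.2 (mem_closedBall_zero_iff.1 hx.1))
      (fun x hx => hdiv x hx.2 (mem_closedBall_zero_iff.1 hx.1)) hθ hθc hθO hθ0
    have hnonneg : ∀ x, 0 ≤ θ x * Q x := fun x => by
      by_cases hx : x ∈ tsupport θ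
      · exact mul_nonneg (hθ0 x) (hQ0 x (hθO hx).2 (mem_closedBall_zero_iff.1 (hθO hx).1))
      · simp [image_eq_zero_of_notMem_tsupport hx]
    have hSsub : S ⊆ closedBall 0 R := fun x hx =>
      mem_closedBall_zero_iff.2 ((hSε x hx).2.1.trans hR.le)
    have hSfin : volume S ≠ ⊤ :=
      ((measure_mono hSsub).trans_lt (isCompact_closedBall _ _).measure_lt_top).ne
    have hlow : q * volume.real S ≤ ∫ x, θ x * Q x := by
      calc q * volume.real S ≤ ∫ x in S, θ x * Q x := by
            refine setIntegral_ge_of_const_le_real hS hSfin (fun x hx => ?_) hint.integrableOn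
            obtain ⟨h1, h2, h3⟩ := hSε x hx
            rwa [hθ1 x (hδε.le.trans h1) h2, one_mul]
        _ ≤ _ := setIntegral_le_integral hint (Filter.Eventually.of_forall hnonneg)
    have hup : ∫ x, ∑ i, fderiv ℝ θ x (EuclideanSpace.single i 1) * V i x ≤
        n * (M * B₁ + 4 * M * B₀ * δ) * vol := by
      rw [← setIntegral_eq_integral_of_forall_compl_eq_zero (s := closedBall 0 R)]
      · refine (le_abs_self _).trans ?_
        rw [← Real.norm_eq_abs]
        refine norm_setIntegral_le_of_norm_le_const
          (isCompact_closedBall _ _).measure_lt_top fun x hx => ?_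
        rw [mem_closedBall_zero_iff] at hx
        refine (norm_sum_le _ _).trans ((Finset.sum_le_card_nsmul _ _
          (M * B₁ + 4 * M * B₀ * δ) fun i _ => ?_).trans_eq
          (by simp only [Finset.card_univ, Fintype.card_fin, nsmul_eq_mul]))
        have hdi : |fderiv ℝ θ x (EuclideanSpace.single i 1)| ≤ ‖fderiv ℝ θ x‖ := by
          simpa using (fderiv ℝ θ x).le_opNorm (EuclideanSpace.single i (1 : ℝ))
        rw [Real.norm_eq_abs, abs_mul]
        have ht1 : 0 ≤ M * B₁ := by positivity
        have ht2 : 0 ≤ 4 * M * B₀ * δ := by positivity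
        rcases eq_or_ne x 0 with rfl | hx0
        · have h0 : fderiv ℝ θ 0 = 0 := image_eq_zero_of_notMem_tsupport fun h =>
            (hθO (tsupport_fderiv_subset ℝ h)).2 rfl
          simp [h0]
          positivity
        rcases le_or_gt ‖x‖ (2 * δ) with h1 | h1
        · have hVx := hball x (mem_ball_zero_iff.2 (h1.trans_lt hδr')) hx0 i
          calc _ ≤ M / δ * (B₀ * (2 * δ) ^ 2) := by
                refine mul_le_mul (hdi.trans (hθin x h1)) (hVx.trans ?_) (abs_nonneg _)
                  (by positivity)
                gcongr
            _ = 4 * M * B₀ * δ := by field_simp; ring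
            _ ≤ _ := by linarith
        rcases lt_or_ge ‖x‖ R₁ with h2 | h2
        · have h : θ =ᶠ[nhds x] fun _ => 1 := by
            filter_upwards [(continuous_norm.tendsto x).eventually (lt_mem_nhds h1),
              (continuous_norm.tendsto x).eventually (gt_mem_nhds h2)] with y hy1 hy2
            exact hθ1 y hy1.le hy2.le
          rw [h.fderiv_eq]
          simp
          positivity
        · calc _ ≤ M * B₁ :=
                mul_le_mul (hdi.trans (hθout x h2)) (hout i x h2 hx) (abs_nonneg _) hM
            _ ≤ _ := by linarith
      · intro x hx
        have h0 : fderiv ℝ θ x = 0 := image_eq_zero_of_notMem_tsupport fun h =>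
          hx (hθO (tsupport_fderiv_subset ℝ h)).1
        simp [h0]
    calc q * volume.real S ≤ n * (M * B₁ + 4 * M * B₀ * δ) * vol := hlow.trans (hle.trans hup)
      _ = _ := by ring
  have hlim : Filter.Tendsto (fun δ : ℝ => n * M * vol * B₁ + δ * (n * (4 * M * B₀) * vol))
      (nhdsWithin 0 (Set.Ioi 0)) (nhds (n * M * vol * B₁)) := by
    have : Filter.Tendsto (fun δ : ℝ => n * M * vol * B₁ + δ * (n * (4 * M * B₀) * vol))
        (nhds 0) (nhds (n * M * vol * B₁ + 0 * (n * (4 * M * B₀) * vol))) :=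
      tendsto_const_nhds.add (Filter.tendsto_id.mul_const _)
    simpa using this.mono_left nhdsWithin_le_nhds
  refine ge_of_tendsto hlim ?_
  have hmin : 0 < min R₁ (min ε r) / 2 := by positivity
  filter_upwards [Ioo_mem_nhdsGT hmin] with δ hδ
  exact key δ hδ.1 (by linarith [hδ.2])

end Cutoff

section Continuation

variable {n d₁ d₂ : ℕ} {u : EuclideanSpace ℝ (Fin n) → EuclideanSpace ℝ (Fin d₁)}
  {v : EuclideanSpace ℝ (Fin n) → EuclideanSpace ℝ (Fin d₂)}

lemma carlemanProfile_le (m : ℕ) {s₀ s : ℝ} (hs₀ : 0 < s₀) (hs : s₀ ≤ s) (hs1 : s ≤ 1) :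
    carlemanProfile m s ≤ s₀⁻¹ ^ m * Real.exp (m / 2) := by
  unfold carlemanProfile
  have h : (m : ℝ) / 2 * s ≤ m / 2 := mul_le_of_le_one_right (by positivity) hs1
  have h0 : 0 ≤ s := hs₀.le.trans hs
  gcongr

lemma pow_le_carlemanProfile (m : ℕ) {s s₀ : ℝ} (hs : 0 < s) (hs₀ : s ≤ s₀) :
    s₀⁻¹ ^ m ≤ carlemanProfile m s := by
  unfold carlemanProfile
  have h : 1 ≤ Real.exp (m / 2 * s) := Real.one_le_exp (by positivity)
  have h0 : 0 < s₀ := hs.trans_le hs₀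
  calc s₀⁻¹ ^ m ≤ s⁻¹ ^ m * 1 := by rw [mul_one]; gcongr
    _ ≤ _ := by gcongr

lemma abs_systemField_le_of_decay {m : ℕ} (hm : 1 ≤ m) {x : EuclideanSpace ℝ (Fin n)}
    (hx : x ≠ 0) (hx1 : sumSq x ≤ 1) {K : ℝ}
    (hK : ‖u x‖ + ‖fderiv ℝ u x‖ + ‖v x‖ ≤ K * sumSq x ^ (m + 2)) (i : Fin n) :
    |systemField m u v i x| ≤
      4 * (d₁ * (18 * n + 60) + d₂) * m ^ 5 * (Real.exp (m / 2) * K) ^ 2 * sumSq x := by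
  have hs := sumSq_pos hx
  refine (abs_systemField_le hm hx hx1 i).trans ?_
  have hp := carlemanProfile_pos m hs
  have hp1 := carlemanProfile_le m hs le_rfl hx1
  have hΦ : 0 ≤ ‖u x‖ + ‖fderiv ℝ u x‖ + ‖v x‖ := by positivity
  have h := mul_le_mul hp1 hK hΦ (hp.le.trans hp1)
  have h2 : (sumSq x)⁻¹ ^ m * Real.exp (m / 2) * (K * sumSq x ^ (m + 2)) =
      Real.exp (m / 2) * K * sumSq x ^ 2 := by
    rw [pow_add, inv_pow]; field_simp
  rw [h2] at h
  calc _ = 4 * (d₁ * (18 * n + 60) + d₂) * m ^ 5 / sumSq x ^ 3 *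
        (carlemanProfile m (sumSq x) * (‖u x‖ + ‖fderiv ℝ u x‖ + ‖v x‖)) ^ 2 := by ring
    _ ≤ 4 * (d₁ * (18 * n + 60) + d₂) * m ^ 5 / sumSq x ^ 3 *
        (Real.exp (m / 2) * K * sumSq x ^ 2) ^ 2 := by gcongr
    _ = _ := by field_simp

lemma abs_systemField_le_of_bound {m : ℕ} (hm : 1 ≤ m) {x : EuclideanSpace ℝ (Fin n)} {s₀ M : ℝ}
    (hs₀ : 0 < s₀) (hx₀ : s₀ ≤ sumSq x) (hx1 : sumSq x ≤ 1)
    (hM : ‖u x‖ + ‖fderiv ℝ u x‖ + ‖v x‖ ≤ M) (i : Fin n) :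
    |systemField m u v i x| ≤ 4 * (d₁ * (18 * n + 60) + d₂) * m ^ 5 / s₀ ^ 3 *
      (s₀⁻¹ ^ m * Real.exp (m / 2)) ^ 2 * M ^ 2 := by
  have hs := hs₀.trans_le hx₀
  have hx : x ≠ 0 := by
    rintro rfl
    simp [sumSq] at hs
  refine (abs_systemField_le hm hx hx1 i).trans ?_
  have hp := (carlemanProfile_pos m hs).le
  have hp1 := carlemanProfile_le m hs₀ hx₀ hx1
  gcongr

/-- The quantities controlled by the system decay faster than any power at a point where the
solution is flat. -/
lemma exists_eventually_jet_le_of_flat (hu : ContDiffAt ℝ (⊤ : ℕ∞) u 0)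
    (hv : ContDiffAt ℝ (⊤ : ℕ∞) v 0) (hu0 : ∀ k : ℕ, iteratedFDeriv ℝ k u 0 = 0)
    (hv0 : ∀ k : ℕ, iteratedFDeriv ℝ k v 0 = 0) (N : ℕ) :
    ∃ K, ∀ᶠ x in nhds (0 : EuclideanSpace ℝ (Fin n)),
      ‖u x‖ + ‖fderiv ℝ u x‖ + ‖v x‖ ≤ K * sumSq x ^ N := by
  obtain ⟨K₁, -, h₁⟩ := exists_eventually_norm_le_of_flat (2 * N) hu hu0
  obtain ⟨K₂, -, h₂⟩ := exists_eventually_norm_le_of_flat (2 * N) (f := fderiv ℝ u)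
    (hu.fderiv_right le_rfl) fun k => by
      rw [← norm_eq_zero, norm_iteratedFDeriv_fderiv, hu0, norm_zero]
  obtain ⟨K₃, -, h₃⟩ := exists_eventually_norm_le_of_flat (2 * N) hv hv0
  refine ⟨K₁ + K₂ + K₃, ?_⟩
  filter_upwards [h₁, h₂, h₃] with x hx₁ hx₂ hx₃
  rw [sumSq_eq_norm_sq, ← pow_mul, add_mul, add_mul]
  gcongr

/-- A positive constant is not bounded by `B * m ^ 5 * (e / 16) ^ m` for all large `m`. -/
lemma not_forall_le_pow_mul_pow {c B : ℝ} (hc : 0 < c) (m₀ : ℕ) :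
    ¬ ∀ m : ℕ, m₀ ≤ m → c ≤ B * ((m : ℝ) ^ 5 * (Real.exp 1 / 16) ^ m) := fun h => by
  have hlt : Real.exp 1 / 16 < 1 := by linarith [Real.exp_one_lt_d9]
  have ht := (tendsto_pow_const_mul_const_pow_of_lt_one 5 (by positivity) hlt).const_mul B
  rw [mul_zero] at ht
  exact hc.not_ge (ge_of_tendsto ht (Filter.eventually_atTop.2 ⟨m₀, h⟩))

/-- A solution of the system which is flat at the origin and smooth near the closed ball of
radius `2 R₁ ≤ 1` vanishes on the ball of radius `R₁ / 2`. -/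
lemma eq_zero_of_flat_of_norm_lt {C R₁ : ℝ} (hR₁ : 0 < R₁) (hR : 2 * R₁ ≤ 1)
    (hu : ∀ x, ‖x‖ ≤ 2 * R₁ → ContDiffAt ℝ (⊤ : ℕ∞) u x)
    (hv : ∀ x, ‖x‖ ≤ 2 * R₁ → ContDiffAt ℝ (⊤ : ℕ∞) v x)
    (hpde : ∀ x, ‖x‖ ≤ 2 * R₁ → ‖lapV u x‖ ≤ C * (‖u x‖ + ‖fderiv ℝ u x‖ + ‖v x‖))
    (hode : ∀ x, ‖x‖ ≤ 2 * R₁ → ‖fderiv ℝ v x x‖ ≤ C * (‖v x‖ + ‖u x‖ + ‖fderiv ℝ u x‖))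
    (hu0 : ∀ k : ℕ, iteratedFDeriv ℝ k u 0 = 0)
    (hv0 : ∀ k : ℕ, iteratedFDeriv ℝ k v 0 = 0)
    {x₀ : EuclideanSpace ℝ (Fin n)} (hx₀ : ‖x₀‖ < R₁ / 2) : u x₀ = 0 ∧ v x₀ = 0 := by
  have hu00 : u 0 = 0 := by simpa using congrArg norm (hu0 0)
  have hv00 : v 0 = 0 := by simpa using congrArg norm (hv0 0)
  rcases eq_or_ne x₀ 0 with rfl | hx₀0
  · exact ⟨hu00, hv00⟩
  by_contra hne
  have hη : 0 < ‖u x₀‖ ^ 2 + ‖v x₀‖ ^ 2 := by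
    rcases not_and_or.1 hne with h | h
    · have := norm_pos_iff.2 h
      positivity
    · have := norm_pos_iff.2 h
      positivity
  set η := ‖u x₀‖ ^ 2 + ‖v x₀‖ ^ 2 with hηdef
  have hx₀n := norm_pos_iff.2 hx₀0
  have hle1 : ∀ x : EuclideanSpace ℝ (Fin n), ‖x‖ ≤ 2 * R₁ → sumSq x ≤ 1 := fun x hx => by
    rw [sumSq_eq_norm_sq]
    exact pow_le_one₀ (norm_nonneg _) (hx.trans hR)
  have hcont : ∀ x, ‖x‖ ≤ 2 * R₁ → ContinuousAt (fun y => ‖u y‖ ^ 2 + ‖v y‖ ^ 2) x := fun x hx =>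
    ((hu x hx).continuousAt.norm.pow 2).add ((hv x hx).continuousAt.norm.pow 2)
  have hdu : ∀ x, ‖x‖ ≤ 2 * R₁ → ContinuousAt (fderiv ℝ u) x := fun x hx =>
    ((hu x hx).fderiv_right (m := (⊤ : ℕ∞)) le_rfl).continuousAt
  have hu2 : ∀ x, ‖x‖ ≤ 2 * R₁ → ContDiffAt ℝ 2 u x := fun x hx =>
    (hu x hx).of_le (WithTop.coe_le_coe.2 (le_top : (2 : ℕ∞) ≤ ⊤))
  have hv1 : ∀ x, ‖x‖ ≤ 2 * R₁ → ContDiffAt ℝ 1 v x := fun x hx =>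
    (hv x hx).of_le (WithTop.coe_le_coe.2 (le_top : (1 : ℕ∞) ≤ ⊤))
  obtain ⟨M, hM⟩ := (isCompact_closedBall
    (0 : EuclideanSpace ℝ (Fin n)) (2 * R₁)).exists_bound_of_continuousOn
    (f := fun x => ‖u x‖ + ‖fderiv ℝ u x‖ + ‖v x‖) fun x hx => by
      rw [mem_closedBall_zero_iff] at hx
      exact (((hu x hx).continuousAt.norm.add (hdu x hx).norm).add
        (hv x hx).continuousAt.norm).continuousWithinAt
  obtain ⟨ρ, hρ, hball⟩ := Metric.eventually_nhds_iff_ball.1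
    (((hcont x₀ (by linarith)).eventually (lt_mem_nhds (half_lt_self hη))).and
      (((continuous_norm.tendsto x₀).eventually (lt_mem_nhds (half_lt_self hx₀n))).and
        ((continuous_norm.tendsto x₀).eventually (gt_mem_nhds hx₀))))
  obtain ⟨A, hA⟩ := exists_cutoff_estimate (n := n) hR₁ (show R₁ < 2 * R₁ by linarith)
  set κ := (‖x₀‖ / 2) ^ 2 * (η / 2) with hκ
  have hvol : 0 < volume.real (ball x₀ ρ) :=
    ENNReal.toReal_pos (measure_ball_pos _ _ hρ).ne' measure_ball_lt_top.ne
  set c₀ : ℝ := 4 * (d₁ * (18 * n + 60) + d₂) with hc₀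
  refine not_forall_le_pow_mul_pow (c := κ * volume.real (ball x₀ ρ))
    (B := A * (c₀ / (R₁ ^ 2) ^ 3 * M ^ 2)) (by positivity)
    (max (n + 4) ⌈8 * (9 * C ^ 2 + 1)⌉₊) fun m hm => ?_
  have hmn : n + 4 ≤ m := (le_max_left _ _).trans hm
  have hmC : 8 * (9 * C ^ 2 + 1) ≤ m := Nat.ceil_le.1 ((le_max_right _ _).trans hm)
  have hm1 : 1 ≤ m := by omega
  obtain ⟨K, hK⟩ := exists_eventually_jet_le_of_flat (hu 0 (by simpa using hR₁.le))
    (hv 0 (by simpa using hR₁.le)) hu0 hv0 (m + 2)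
  have hmain := hA (systemField m u v)
    (fun x => carlemanProfile m (sumSq x) ^ 2 * (sumSq x * (‖u x‖ ^ 2 + ‖v x‖ ^ 2)))
    (c₀ * m ^ 5 * (Real.exp (m / 2) * K) ^ 2)
    (c₀ * m ^ 5 / (R₁ ^ 2) ^ 3 * ((R₁ ^ 2)⁻¹ ^ m * Real.exp (m / 2)) ^ 2 * M ^ 2)
    ((((R₁ / 2) ^ 2)⁻¹ ^ m) ^ 2 * κ) (ball x₀ ρ) (by positivity) (by positivity)
    (fun i x hx hxR => contDiffAt_systemField m hx (hu2 x hxR)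
      (hv1 x hxR) i)
    (fun x hx hxR => ((contDiffAt_carlemanProfile m (k := 0) hx).continuousAt.pow 2).mul
      (ContinuousAt.mul (by unfold sumSq; fun_prop) (hcont x hxR)))
    (fun x hx hxR => systemField_divergence_le hx (hle1 x hxR) hmn hmC
      (hu2 x hxR) (hv1 x hxR)
      (hpde x hxR) (hode x hxR))
    (fun x hx _ => by have := sumSq_pos hx; positivity)
    (by
      rw [eventually_nhdsWithin_iff]
      filter_upwards [hK, Metric.closedBall_mem_nhds (0 : EuclideanSpace ℝ (Fin n))
        (show 0 < 2 * R₁ by linarith)] with x hx hxR hx0 i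
      rw [← sumSq_eq_norm_sq]
      exact abs_systemField_le_of_decay hm1 hx0 (hle1 x (mem_closedBall_zero_iff.1 hxR)) hx i)
    (fun i x h1 h2 => abs_systemField_le_of_bound hm1 (by positivity)
      (by rw [sumSq_eq_norm_sq]; gcongr) (hle1 x h2)
      ((le_abs_self _).trans (hM x (mem_closedBall_zero_iff.2 h2))) i)
    measurableSet_ball
    ⟨‖x₀‖ / 2, by positivity, fun x hx => by
      obtain ⟨h1, h2, h3⟩ := hball x hx
      have hs : 0 < sumSq x := by rw [sumSq_eq_norm_sq]; exact pow_pos (by linarith) 2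
      refine ⟨h2.le, by linarith, ?_⟩
      have h4 := pow_le_carlemanProfile m hs
        (show sumSq x ≤ (R₁ / 2) ^ 2 by rw [sumSq_eq_norm_sq]; gcongr)
      have h5 : (‖x₀‖ / 2) ^ 2 ≤ sumSq x := by rw [sumSq_eq_norm_sq]; gcongr
      rw [hκ]
      gcongr⟩
  have he : Real.exp ((m : ℝ) / 2) ^ 2 = Real.exp 1 ^ m := by
    rw [← Real.exp_nat_mul, ← Real.exp_nat_mul]
    congr 1
    push_cast
    ring
  have hpos : 0 < (((R₁ / 2) ^ 2)⁻¹ ^ m) ^ 2 := by positivity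
  refine le_of_mul_le_mul_left ?_ hpos
  calc _ = (((R₁ / 2) ^ 2)⁻¹ ^ m) ^ 2 * κ * volume.real (ball x₀ ρ) := by ring
    _ ≤ _ := hmain
    _ = _ := by
      have h16 : ((R₁ ^ 2)⁻¹ ^ m) ^ 2 = (((R₁ / 2) ^ 2)⁻¹ ^ m) ^ 2 * (1 / 16) ^ m := by
        rw [← pow_mul, ← pow_mul, mul_comm m 2, pow_mul, pow_mul, ← mul_pow]
        congr 1
        field_simp
        norm_num
      rw [mul_pow _ (Real.exp _), he, h16, div_eq_mul_one_div (Real.exp 1), mul_pow (Real.exp 1)]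
      ring

end Continuation

/-- Strong unique continuation for the vector-valued model PDE–ODE system
(Proposition 2.3 / Remark 2.4, vector-valued form): if smooth `u : ℝⁿ → ℝ^{d₁}` and
`v : ℝⁿ → ℝ^{d₂}` on a neighborhood of the origin satisfy
`|Δu| ≤ C(|u| + ‖Du‖ + |v|)` and `|Dv(x)(x)| ≤ C(|v| + |u| + ‖Du‖)`, and both vanish
to infinite order at the origin, then `u ≡ v ≡ 0` on some neighborhood of the origin. -/
theorem sucp_pde_ode_system_vector (n : ℕ) (hn : 2 < n) (d₁ d₂ : ℕ) (hd₁ : 1 ≤ d₁)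
    (hd₂ : 1 ≤ d₂) (C : ℝ) (hC : 0 ≤ C)
    (U : Set (EuclideanSpace ℝ (Fin n))) (hU : IsOpen U) (h0U : (0 : EuclideanSpace ℝ (Fin n)) ∈ U)
    (u : EuclideanSpace ℝ (Fin n) → EuclideanSpace ℝ (Fin d₁))
    (v : EuclideanSpace ℝ (Fin n) → EuclideanSpace ℝ (Fin d₂))
    (hu : ContDiffOn ℝ (⊤ : ℕ∞) u U) (hv : ContDiffOn ℝ (⊤ : ℕ∞) v U)
    (hpde : ∀ x ∈ U, ‖lapV u x‖ ≤ C * (‖u x‖ + ‖fderiv ℝ u x‖ + ‖v x‖))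
    (hode : ∀ x ∈ U, ‖fderiv ℝ v x x‖ ≤ C * (‖v x‖ + ‖u x‖ + ‖fderiv ℝ u x‖))
    (hu0 : ∀ k : ℕ, iteratedFDeriv ℝ k u 0 = 0)
    (hv0 : ∀ k : ℕ, iteratedFDeriv ℝ k v 0 = 0) :
    ∃ W : Set (EuclideanSpace ℝ (Fin n)), IsOpen W ∧ (0 : EuclideanSpace ℝ (Fin n)) ∈ W ∧
      ∀ x ∈ W, u x = 0 ∧ v x = 0 := by
  obtain ⟨r, hr, hball⟩ := Metric.isOpen_iff.1 hU 0 h0U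
  have hR₁ : 0 < min (1 / 2) (r / 4) := by positivity
  have hsub : ∀ x : EuclideanSpace ℝ (Fin n), ‖x‖ ≤ 2 * min (1 / 2) (r / 4) → x ∈ U := fun x hx =>
    hball (mem_ball_zero_iff.2 (by linarith [min_le_right (1 / 2) (r / 4)]))
  refine ⟨ball 0 (min (1 / 2) (r / 4) / 2), isOpen_ball, mem_ball_self (by positivity),
    fun x hx => ?_⟩
  exact eq_zero_of_flat_of_norm_lt hR₁ (by linarith [min_le_left (1 / 2) (r / 4)])
    (fun y hy => hu.contDiffAt (hU.mem_nhds (hsub y hy)))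
    (fun y hy => hv.contDiffAt (hU.mem_nhds (hsub y hy)))
    (fun y hy => hpde y (hsub y hy)) (fun y hy => hode y (hsub y hy)) hu0 hv0
    (mem_ball_zero_iff.1 hx)
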